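/- arXiv:2507.22949 — 9 statements merged into one kernel-verified Lean document; each statement's English description precedes it below -/
import Mathlib

section
/- Suppose μ is a cell-centered grid function (with the discrete homogeneous Neumann ghost extension), u = (uˣ,uʸ) is a MAC vector grid function satisfying the discrete no-penetration condition, φ is a cell-centered grid function, q, τ ∈ ℝ with τ > 0, and cell-centered grid functions φⁿ⁺¹, φⁿ, φⁿ⁻¹ satisfy (3φⁿ⁺¹ − 4φⁿ + φⁿ⁻¹)/(2τ) + q·∇_h·(φu) = Δ_h μ at every cell, where ∇_h·(φu) is the cell-centered function D (∇_h·(φu))_{i+1/2,j+1/2} = (uˣ_{i+1,j+1/2}(A_xφ)_{i+1,j+1/2} − uˣ_{i,j+1/2}(A_xφ)_{i,j+1/2})/h + (uʸ_{i+1/2,j+1}(A_yφ)_{i+1/2,j+1} − uʸ_{i+1/2,j}(A_yφ)_{i+1/2,j})/h with A_xφ_{i,j+1/2} = (φ_{i−1/2,j+1/2} + φ_{i+1/2,j+1/2})/2 and A_yφ_{i+1/2,j} = (φ_{i+1/2,j−1/2} + φ_{i+1/2,j+1/2})/2. If the discrete means m(φⁿ) := h²Σφⁿ and m(φⁿ⁻¹)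 are equal, then m(φⁿ⁺¹) = m(φⁿ); i.e., the scheme conserves the discrete mass of the phase variable. -/
noncomputable section
open Finset

namespace MAC

/-- Clamp an integer index into the range `[0, N-1]`; used to implement the
single-layer mirror (ghost) extensions on the MAC grid. -/
def cl (N : ℕ) (i : ℤ) : ℤ := max 0 (min i ((N : ℤ) - 1))

/-- Discrete homogeneous Neumann (mirror) ghost extension of a cell-centered
grid function `f`, where `f i j` stands for `f_{i+1/2,j+1/2}`, `0 ≤ i,j ≤ N-1`. -/
def extC (N : ℕ) (f : ℤ → ℤ → ℝ) (i j : ℤ) : ℝ := f (cl N i) (cl N j)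

/-- Free-slip ghost extension of the x-component of a MAC vector
(`f i j` stands for `uˣ_{i,j+1/2}`): mirror reflection in `j`. -/
def extX (N : ℕ) (f : ℤ → ℤ → ℝ) (i j : ℤ) : ℝ := f i (cl N j)

/-- Free-slip ghost extension of the y-component of a MAC vector
(`f i j` stands for `uʸ_{i+1/2,j}`): mirror reflection in `i`. -/
def extY (N : ℕ) (f : ℤ → ℤ → ℝ) (i j : ℤ) : ℝ := f (cl N i) j

/-- Discrete cell-centered inner product `⟨f,g⟩_c`. -/
def ipC (N : ℕ) (h : ℝ) (f g : ℤ → ℤ → ℝ) : ℝ :=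
  h ^ 2 * ∑ i ∈ range N, ∑ j ∈ range N, f i j * g i j

/-- Discrete mean `h² Σ f`. -/
def meanC (N : ℕ) (h : ℝ) (f : ℤ → ℤ → ℝ) : ℝ :=
  h ^ 2 * ∑ i ∈ range N, ∑ j ∈ range N, f i j

/-- MAC vector inner product `⟨u,v⟩₁`, summing over all edge points. -/
def ipV (N : ℕ) (h : ℝ) (ux uy vx vy : ℤ → ℤ → ℝ) : ℝ :=
  h ^ 2 * ∑ i ∈ range (N + 1), ∑ j ∈ range N, ux i j * vx i j
    + h ^ 2 * ∑ i ∈ range N, ∑ j ∈ range (N + 1), uy i j * vy i j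

/-- `‖f‖₂²` for a cell-centered function. -/
def normC2 (N : ℕ) (h : ℝ) (f : ℤ → ℤ → ℝ) : ℝ := ipC N h f f

/-- `‖u‖₂²` for a MAC vector. -/
def normV2 (N : ℕ) (h : ℝ) (ux uy : ℤ → ℤ → ℝ) : ℝ := ipV N h ux uy ux uy

/-- x-component of the MAC gradient of a cell-centered function,
located at east-west edge points `(i, j+1/2)`, `0 ≤ i ≤ N`, `0 ≤ j ≤ N-1`. -/
def gradX (N : ℕ) (h : ℝ) (f : ℤ → ℤ → ℝ) (i j : ℤ) : ℝ :=
  (extC N f i j - extC N f (i - 1) j) / h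

/-- y-component of the MAC gradient of a cell-centered function,
located at north-south edge points `(i+1/2, j)`. -/
def gradY (N : ℕ) (h : ℝ) (f : ℤ → ℤ → ℝ) (i j : ℤ) : ℝ :=
  (extC N f i j - extC N f i (j - 1)) / h

/-- Five-point Laplacian of a cell-centered function (Neumann ghosts). -/
def lapC (N : ℕ) (h : ℝ) (f : ℤ → ℤ → ℝ) (i j : ℤ) : ℝ :=
  (extC N f (i + 1) j + extC N f (i - 1) j + extC N f i (j + 1)
      + extC N f i (j - 1) - 4 * extC N f i j) / h ^ 2

/-- MAC divergence of a vector at cell centers. -/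
def divV (h : ℝ) (ux uy : ℤ → ℤ → ℝ) (i j : ℤ) : ℝ :=
  (ux (i + 1) j - ux i j) / h + (uy i (j + 1) - uy i j) / h

/-- `‖∇_h f‖₂²` for a cell-centered function (gradient components summed over
all edge points). -/
def gnormC2 (N : ℕ) (h : ℝ) (f : ℤ → ℤ → ℝ) : ℝ :=
  normV2 N h (gradX N h f) (gradY N h f)

/-- Average of a cell-centered function to east-west edge points. -/
def avX (N : ℕ) (f : ℤ → ℤ → ℝ) (i j : ℤ) : ℝ :=
  (extC N f (i - 1) j + extC N f i j) / 2

/-- Average of a cell-centered function to north-south edge points. -/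
def avY (N : ℕ) (f : ℤ → ℤ → ℝ) (i j : ℤ) : ℝ :=
  (extC N f i (j - 1) + extC N f i j) / 2

/-- MAC divergence `∇_h·(f u)` with edge-averaged `f`, at cell centers. -/
def divFU (N : ℕ) (h : ℝ) (f ux uy : ℤ → ℤ → ℝ) (i j : ℤ) : ℝ :=
  (ux (i + 1) j * avX N f (i + 1) j - ux i j * avX N f i j) / h
    + (uy i (j + 1) * avY N f i (j + 1) - uy i j * avY N f i j) / h

/-- Componentwise MAC Laplacian of the x-component (free-slip tangential ghosts). -/
def lapVX (N : ℕ) (h : ℝ) (ux : ℤ → ℤ → ℝ) (i j : ℤ) : ℝ :=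
  (ux (i + 1) j + ux (i - 1) j + extX N ux i (j + 1) + extX N ux i (j - 1)
      - 4 * ux i j) / h ^ 2

/-- Componentwise MAC Laplacian of the y-component (free-slip tangential ghosts). -/
def lapVY (N : ℕ) (h : ℝ) (uy : ℤ → ℤ → ℝ) (i j : ℤ) : ℝ :=
  (extY N uy (i + 1) j + extY N uy (i - 1) j + uy i (j + 1) + uy i (j - 1)
      - 4 * uy i j) / h ^ 2

/-- `‖∇_h v‖₂²` for a MAC vector `v`. -/
def gnormV2 (N : ℕ) (h : ℝ) (ux uy : ℤ → ℤ → ℝ) : ℝ :=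
  h ^ 2 * ∑ i ∈ range N, ∑ j ∈ range N, ((ux (i + 1) j - ux i j) / h) ^ 2
    + h ^ 2 * ∑ i ∈ range (N + 1), ∑ j ∈ range (N + 1),
        ((extX N ux i j - extX N ux i (j - 1)) / h) ^ 2
    + h ^ 2 * ∑ i ∈ range (N + 1), ∑ j ∈ range (N + 1),
        ((extY N uy i j - extY N uy (i - 1) j) / h) ^ 2
    + h ^ 2 * ∑ i ∈ range N, ∑ j ∈ range N, ((uy i (j + 1) - uy i j) / h) ^ 2

/-- `‖v‖₄` for a MAC vector. -/
noncomputable def norm4V (N : ℕ) (h : ℝ) (ux uy : ℤ → ℤ → ℝ) : ℝ :=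
  (h ^ 2 * ∑ i ∈ range (N + 1), ∑ j ∈ range N, |ux i j| ^ 4
      + h ^ 2 * ∑ i ∈ range N, ∑ j ∈ range (N + 1), |uy i j| ^ 4) ^ ((1 : ℝ) / 4)

/-- Discrete no-penetration boundary condition. -/
def NoPen (N : ℕ) (ux uy : ℤ → ℤ → ℝ) : Prop :=
  (∀ j : ℤ, 0 ≤ j → j < N → ux 0 j = 0 ∧ ux N j = 0) ∧
    (∀ i : ℤ, 0 ≤ i → i < N → uy i 0 = 0 ∧ uy i N = 0)

/-- Discrete SAV energy `E_{1,h}`. -/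
def E1h (N : ℕ) (h : ℝ) (f : ℤ → ℤ → ℝ) : ℝ :=
  h ^ 2 * ∑ i ∈ range N, ∑ j ∈ range N,
    ((1 / 4) * f i j ^ 4 - (1 / 2) * f i j ^ 2 + 5 / 4)

end MAC

end

namespace MAC

open Finset

/-- Discrete divergence theorem: the divergence of a MAC vector with vanishing normal component
on the boundary sums to zero. -/
theorem NoPen.sum_divV_eq_zero {N : ℕ} {ux uy : ℤ → ℤ → ℝ} (hbc : NoPen N ux uy) (h : ℝ) :
    ∑ i ∈ range N, ∑ j ∈ range N, divV h ux uy i j = 0 := by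
  have telescope (f : ℤ → ℝ) : ∑ i ∈ range N, (f (i + 1) - f i) = f N - f 0 := by
    simpa using sum_range_sub (fun i : ℕ => f i) N
  have hx : ∑ i ∈ range N, ∑ j ∈ range N, (ux (i + 1) j - ux i j) / h = 0 := by
    rw [sum_comm]
    refine sum_eq_zero fun j hj => ?_
    obtain ⟨h0, h1⟩ := hbc.1 j (by positivity) (by exact_mod_cast mem_range.1 hj)
    rw [← sum_div, telescope fun i => ux i j, h0, h1, sub_zero, zero_div]
  have hy : ∑ i ∈ range N, ∑ j ∈ range N, (uy i (j + 1) - uy i j) / h = 0 := by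
    refine sum_eq_zero fun i hi => ?_
    obtain ⟨h0, h1⟩ := hbc.2 i (by positivity) (by exact_mod_cast mem_range.1 hi)
    rw [← sum_div, telescope fun j => uy i j, h0, h1, sub_zero, zero_div]
  simp only [divV, sum_add_distrib, hx, hy, add_zero]

theorem cl_zero_sub_one (N : ℕ) : cl N (0 - 1) = cl N 0 := by
  simp only [cl]; omega

theorem cl_natCast_sub_one (N : ℕ) : cl N (N - 1) = cl N N := by
  simp only [cl]; omega

/-- The Neumann ghost extension makes the normal gradient vanish on the boundary. -/
theorem noPen_grad (N : ℕ) (h : ℝ) (f : ℤ → ℤ → ℝ) : NoPen N (gradX N h f) (gradY N h f) := by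
  constructor <;> intro k _ _ <;>
    simp only [gradX, gradY, extC, cl_zero_sub_one, cl_natCast_sub_one, sub_self, zero_div,
      and_self]

theorem lapC_eq_divV_grad (N : ℕ) (h : ℝ) (f : ℤ → ℤ → ℝ) (i j : ℤ) :
    lapC N h f i j = divV h (gradX N h f) (gradY N h f) i j := by
  simp only [lapC, divV, gradX, gradY, add_sub_cancel_right]
  ring

theorem NoPen.mul {N : ℕ} {ux uy : ℤ → ℤ → ℝ} (hbc : NoPen N ux uy) (a b : ℤ → ℤ → ℝ) :
    NoPen N (fun i j => ux i j * a i j) (fun i j => uy i j * b i j) := by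
  refine ⟨fun j h0 h1 => ?_, fun i h0 h1 => ?_⟩
  · simp [hbc.1 j h0 h1]
  · simp [hbc.2 i h0 h1]

theorem sum_lapC_eq_zero (N : ℕ) (h : ℝ) (f : ℤ → ℤ → ℝ) :
    ∑ i ∈ range N, ∑ j ∈ range N, lapC N h f i j = 0 := by
  simp only [lapC_eq_divV_grad, (noPen_grad N h f).sum_divV_eq_zero]

theorem NoPen.sum_divFU_eq_zero {N : ℕ} {ux uy : ℤ → ℤ → ℝ} (hbc : NoPen N ux uy) (h : ℝ)
    (f : ℤ → ℤ → ℝ) : ∑ i ∈ range N, ∑ j ∈ range N, divFU N h f ux uy i j = 0 :=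
  (hbc.mul (avX N f) (avY N f)).sum_divV_eq_zero h

end MAC

open Finset in
/-- **Discrete mass conservation** for the phase update of the SAV-ZEC scheme:
if `(3φⁿ⁺¹ − 4φⁿ + φⁿ⁻¹)/(2τ) + q ∇_h·(φu) = Δ_h μ` at every cell, `u`
satisfies the discrete no-penetration condition, and the discrete means of
`φⁿ` and `φⁿ⁻¹` coincide, then the discrete mean of `φⁿ⁺¹` equals that of `φⁿ`. -/
theorem mass_conservation (N : ℕ) (hN : 2 ≤ N) (h : ℝ) (hh : h = 1 / N)
    (q τ : ℝ) (hτ : 0 < τ)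
    (μ φ : ℤ → ℤ → ℝ) (ux uy : ℤ → ℤ → ℝ) (φp φn φm : ℤ → ℤ → ℝ)
    (hbc : MAC.NoPen N ux uy)
    (hscheme : ∀ i ∈ range N, ∀ j ∈ range N,
      (3 * φp i j - 4 * φn i j + φm i j) / (2 * τ)
          + q * MAC.divFU N h φ ux uy i j = MAC.lapC N h μ i j)
    (hmean : MAC.meanC N h φn = MAC.meanC N h φm) :
    MAC.meanC N h φp = MAC.meanC N h φn := by
  have hsum := sum_congr rfl fun i hi => sum_congr rfl fun j hj => hscheme i hi j hj
  simp only [sum_add_distrib, ← mul_sum, ← sum_div, sum_sub_distrib, hbc.sum_divFU_eq_zero,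
    MAC.sum_lapC_eq_zero, mul_zero, add_zero] at hsum
  have hzero := (div_eq_zero_iff.1 hsum).resolve_right (by positivity)
  simp only [MAC.meanC] at hmean ⊢
  linear_combination (h ^ 2 / 3) * hzero + (1 / 3) * hmean
end

section
/- Let u = (uˣ,uʸ) be a MAC vector grid function satisfying the discrete no-penetration condition, and let f, g be cell-centered grid functions (with the discrete homogeneous Neumann ghost extension). Then the summation-by-parts identity −⟨g, ∇_h·(f u)⟩_c = ⟨u, f ∇_h g⟩₁ holds, where ∇_h·(f u) is the cell-centered function obtained by the MAC discretization with edge-averaged f, and f ∇_h g is the MAC vector ((A_x f)(∇_h g)ˣ, (A_y f)(∇_h g)ʸ). -/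
/-- Abel summation on an integer grid starting at `0`. -/
theorem sum_mul_backward_diff_add_sum_mul_forward_diff (F G : ℤ → ℝ) (n : ℕ) :
    ∑ i ∈ Finset.range (n + 1), F i * (G i - G (i - 1))
      + ∑ i ∈ Finset.range n, G i * (F (i + 1) - F i) = F n * G n - F 0 * G (-1) := by
  induction n with
  | zero => simp [mul_sub]
  | succ n ih =>
    rw [Finset.sum_range_succ, Finset.sum_range_succ (fun i : ℕ => G i * (F (i + 1) - F i))]
    push_cast
    rw [add_sub_cancel_right]
    linear_combination ih

theorem sum_mul_backward_diff_of_boundary_zero {F : ℤ → ℝ} (G : ℤ → ℝ) {n : ℕ}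
    (h_left : F 0 = 0) (h_right : F n = 0) :
    ∑ i ∈ Finset.range (n + 1), F i * (G i - G (i - 1))
      = -∑ i ∈ Finset.range n, G i * (F (i + 1) - F i) := by
  have key := sum_mul_backward_diff_add_sum_mul_forward_diff F G n
  rw [h_left, h_right] at key
  linear_combination key

theorem MAC.cl_of_lt {N i : ℕ} (hi : i < N) : MAC.cl N i = i := by
  unfold MAC.cl
  omega

theorem MAC.extC_of_lt {N i j : ℕ} (f : ℤ → ℤ → ℝ) (hi : i < N) (hj : j < N) :
    MAC.extC N f i j = f i j := by
  rw [MAC.extC, MAC.cl_of_lt hi, MAC.cl_of_lt hj]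

/-- Summation by parts along a grid row. -/
theorem MAC.sum_row_avX_gradX {N j : ℕ} (h : ℝ) {ux : ℤ → ℤ → ℝ} (f g : ℤ → ℤ → ℝ) (hj : j < N)
    (h_left : ux 0 j = 0) (h_right : ux N j = 0) :
    ∑ i ∈ Finset.range (N + 1), ux i j * (MAC.avX N f i j * MAC.gradX N h g i j)
      = -∑ i ∈ Finset.range N,
          g i j * ((ux (i + 1) j * MAC.avX N f (i + 1) j - ux i j * MAC.avX N f i j) / h) := by
  have key := sum_mul_backward_diff_of_boundary_zero
    (F := fun i => ux i j * MAC.avX N f i j / h) (fun i => MAC.extC N g i j) (n := N)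
    (by simp [h_left]) (by simp [h_right])
  refine Eq.trans (Finset.sum_congr rfl fun i _ => ?_) (key.trans (congrArg Neg.neg
    (Finset.sum_congr rfl fun i hi => ?_)))
  · simp only [MAC.gradX]
    ring
  · simp only [MAC.extC_of_lt g (Finset.mem_range.mp hi) hj]
    ring

/-- Summation by parts along a grid column. -/
theorem MAC.sum_column_avY_gradY {N i : ℕ} (h : ℝ) {uy : ℤ → ℤ → ℝ} (f g : ℤ → ℤ → ℝ) (hi : i < N)
    (h_bottom : uy i 0 = 0) (h_top : uy i N = 0) :
    ∑ j ∈ Finset.range (N + 1), uy i j * (MAC.avY N f i j * MAC.gradY N h g i j)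
      = -∑ j ∈ Finset.range N,
          g i j * ((uy i (j + 1) * MAC.avY N f i (j + 1) - uy i j * MAC.avY N f i j) / h) := by
  have key := sum_mul_backward_diff_of_boundary_zero
    (F := fun j => uy i j * MAC.avY N f i j / h) (fun j => MAC.extC N g i j) (n := N)
    (by simp [h_bottom]) (by simp [h_top])
  refine Eq.trans (Finset.sum_congr rfl fun j _ => ?_) (key.trans (congrArg Neg.neg
    (Finset.sum_congr rfl fun j hj => ?_)))
  · simp only [MAC.gradY]
    ring
  · simp only [MAC.extC_of_lt g hi (Finset.mem_range.mp hj)]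
    ring

/-- **Summation by parts** for the MAC convection form:
`−⟨g, ∇_h·(f u)⟩_c = ⟨u, f ∇_h g⟩₁`, where `∇_h·(f u)` uses edge-averaged `f`
and `f ∇_h g = ((A_x f)(∇_h g)ˣ, (A_y f)(∇_h g)ʸ)`. -/
theorem sbp_convection (N : ℕ) (hN : 2 ≤ N) (h : ℝ) (hh : h = 1 / N)
    (ux uy f g : ℤ → ℤ → ℝ)
    (hbc : MAC.NoPen N ux uy) :
    -MAC.ipC N h g (MAC.divFU N h f ux uy)
      = MAC.ipV N h ux uy
          (fun i j => MAC.avX N f i j * MAC.gradX N h g i j)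
          (fun i j => MAC.avY N f i j * MAC.gradY N h g i j) := by
  obtain ⟨hx, hy⟩ := hbc
  have row : ∀ j ∈ Finset.range N, _ := fun j hj =>
    have hjN := Finset.mem_range.mp hj
    have hb := hx j (by omega) (by omega)
    MAC.sum_row_avX_gradX h f g hjN hb.1 hb.2
  have column : ∀ i ∈ Finset.range N, _ := fun i hi =>
    have hiN := Finset.mem_range.mp hi
    have hb := hy i (by omega) (by omega)
    MAC.sum_column_avY_gradY h f g hiN hb.1 hb.2
  simp only [MAC.ipC, MAC.ipV, MAC.divFU, mul_add, Finset.sum_add_distrib]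
  rw [Finset.sum_comm (s := Finset.range (N + 1)), Finset.sum_congr rfl row,
    Finset.sum_congr rfl column, Finset.sum_neg_distrib, Finset.sum_neg_distrib,
    Finset.sum_comm (s := Finset.range N) (t := Finset.range N)
      (f := fun j i : ℕ => g i j *
        ((ux (i + 1) j * MAC.avX N f (i + 1) j - ux i j * MAC.avX N f i j) / h))]
  ring
end

section
/- There exists a constant C₀ > 0, independent of the grid resolution, such that for every integer N ≥ 2 (h = 1/N) and every cell-centered grid function φ with zero discrete mean h² Σ_{i,j} φ_{i+1/2,j+1/2} = 0, the discrete Poincaré inequality ‖φ‖₂ ≤ C₀ ‖∇_h φ‖₂ holds. -/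
namespace MAC

theorem cl_of_mem_range {N k : ℕ} (hk : k ∈ Finset.range N) : cl N k = k := by
  have := Finset.mem_range.1 hk
  unfold cl
  omega

theorem extC_of_mem_range {N i j : ℕ} (φ : ℤ → ℤ → ℝ) (hi : i ∈ Finset.range N)
    (hj : j ∈ Finset.range N) : extC N φ i j = φ i j := by
  rw [extC, cl_of_mem_range hi, cl_of_mem_range hj]

/-- The oscillation of a finite sequence is controlled by its increments. -/
theorem sq_sub_le_mul_sum_sq_increments (a : ℕ → ℝ) {N k l : ℕ}
    (hk : k ∈ Finset.range N) (hl : l ∈ Finset.range N) :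
    (a k - a l) ^ 2 ≤ N * ∑ m ∈ Finset.range N, (a (m + 1) - a m) ^ 2 := by
  wlog hkl : k ≤ l generalizing k l
  · rw [sub_sq_comm]
    exact this hl hk (le_of_not_ge hkl)
  have hlN := Finset.mem_range.1 hl
  have hsub : Finset.Ico k l ⊆ Finset.range N := fun m hm =>
    Finset.mem_range.2 ((Finset.mem_Ico.1 hm).2.trans hlN)
  rw [sub_sq_comm, ← Finset.sum_Ico_sub a hkl]
  refine sq_sum_le_card_mul_sum_sq.trans ?_
  gcongr
  rw [Nat.card_Ico]
  omega

/-- One-dimensional estimate for a sequence indexed by the integers, with the increments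
taken at the `N + 1` edge points. -/
theorem sq_sub_le_mul_sum_sq_backward (a : ℤ → ℝ) {N k l : ℕ}
    (hk : k ∈ Finset.range N) (hl : l ∈ Finset.range N) :
    (a k - a l) ^ 2 ≤ N * ∑ m ∈ Finset.range (N + 1), (a m - a ((m : ℤ) - 1)) ^ 2 := by
  refine (sq_sub_le_mul_sum_sq_increments (fun m => a m) hk hl).trans ?_
  gcongr
  rw [Finset.sum_range_succ']
  refine le_add_of_le_of_nonneg (le_of_eq ?_) (sq_nonneg _)
  simp

/-- A zero-mean double array has its square sum given by the sum of squared differences. -/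
theorem sum_sq_sub_of_sum_eq_zero {ι : Type*} (s : Finset ι) (f : ι → ι → ℝ)
    (hf : ∑ i ∈ s, ∑ j ∈ s, f i j = 0) :
    ∑ i ∈ s, ∑ j ∈ s, ∑ k ∈ s, ∑ l ∈ s, (f i j - f k l) ^ 2
      = 2 * (s.card : ℝ) ^ 2 * ∑ i ∈ s, ∑ j ∈ s, f i j ^ 2 := by
  simp only [sub_sq, Finset.sum_add_distrib, Finset.sum_sub_distrib, ← Finset.mul_sum, hf,
    Finset.sum_const, nsmul_eq_mul, mul_zero]
  ring

theorem gnormC2_eq {N : ℕ} (hN : N ≠ 0) (φ : ℤ → ℤ → ℝ) :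
    gnormC2 N (1 / N) φ
      = ∑ j ∈ Finset.range N, ∑ m ∈ Finset.range (N + 1),
          (extC N φ m j - extC N φ ((m : ℤ) - 1) j) ^ 2
        + ∑ i ∈ Finset.range N, ∑ m ∈ Finset.range (N + 1),
          (extC N φ i m - extC N φ i ((m : ℤ) - 1)) ^ 2 := by
  have hN' : (N : ℝ) ≠ 0 := Nat.cast_ne_zero.2 hN
  have key : ∀ x : ℝ, (1 / (N : ℝ)) ^ 2 * (x / (1 / N) * (x / (1 / N))) = x ^ 2 := by
    intro x
    field_simp
  simp only [gnormC2, normV2, ipV, gradX, gradY, Finset.mul_sum, key]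
  rw [Finset.sum_comm]

theorem normC2_le_gnormC2 {N : ℕ} (hN : N ≠ 0) (φ : ℤ → ℤ → ℝ)
    (hφ : meanC N (1 / N) φ = 0) :
    normC2 N (1 / N) φ ≤ gnormC2 N (1 / N) φ := by
  have hN' : (0 : ℝ) < N := Nat.cast_pos.2 (Nat.pos_of_ne_zero hN)
  have hmean : ∑ i ∈ Finset.range N, ∑ j ∈ Finset.range N, φ i j = 0 :=
    (mul_eq_zero.1 hφ).resolve_left (by positivity)
  rw [gnormC2_eq hN]
  set X : ℕ → ℝ := fun j => ∑ m ∈ Finset.range (N + 1),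
    (extC N φ m j - extC N φ ((m : ℤ) - 1) j) ^ 2
  set Y : ℕ → ℝ := fun i => ∑ m ∈ Finset.range (N + 1),
    (extC N φ i m - extC N φ i ((m : ℤ) - 1)) ^ 2
  have hpt : ∀ i ∈ Finset.range N, ∀ j ∈ Finset.range N, ∀ k ∈ Finset.range N,
      ∀ l ∈ Finset.range N, (φ i j - φ k l) ^ 2 ≤ 2 * N * X j + 2 * N * Y k := by
    intro i hi j hj k hk l hl
    have hx : (extC N φ i j - extC N φ k j) ^ 2 ≤ N * X j :=
      sq_sub_le_mul_sum_sq_backward (fun m => extC N φ m j) hi hk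
    have hy : (extC N φ k j - extC N φ k l) ^ 2 ≤ N * Y k :=
      sq_sub_le_mul_sum_sq_backward (fun m => extC N φ k m) hj hl
    rw [extC_of_mem_range φ hi hj, extC_of_mem_range φ hk hj] at hx
    rw [extC_of_mem_range φ hk hj, extC_of_mem_range φ hk hl] at hy
    nlinarith [sq_nonneg ((φ i j - φ k j) - (φ k j - φ k l))]
  have hsum := Finset.sum_le_sum fun i hi => Finset.sum_le_sum fun j hj =>
    Finset.sum_le_sum fun k hk => Finset.sum_le_sum fun l hl => hpt i hi j hj k hk l hl
  rw [sum_sq_sub_of_sum_eq_zero (Finset.range N) (fun i j : ℕ => φ i j) hmean] at hsum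
  simp only [Finset.sum_add_distrib, ← Finset.mul_sum, Finset.sum_const, nsmul_eq_mul,
    Finset.card_range] at hsum
  have hsq : ∑ i ∈ Finset.range N, ∑ j ∈ Finset.range N, φ i j ^ 2
      ≤ (N : ℝ) ^ 2 * (∑ j ∈ Finset.range N, X j + ∑ i ∈ Finset.range N, Y i) := by
    refine le_of_mul_le_mul_left (hsum.trans_eq ?_) (by positivity : (0 : ℝ) < 2 * N ^ 2)
    ring
  simp only [normC2, ipC, ← sq]
  rw [one_div, inv_pow, inv_mul_le_iff₀ (by positivity)]
  exact hsq

end MAC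

/-- **Discrete Poincaré inequality** for zero-mean cell-centered functions:
there is a constant `C₀ > 0`, independent of the resolution, with
`‖φ‖₂ ≤ C₀ ‖∇_h φ‖₂`. -/
theorem discrete_poincare_cell :
    ∃ C₀ : ℝ, 0 < C₀ ∧ ∀ N : ℕ, 2 ≤ N → ∀ φ : ℤ → ℤ → ℝ,
      MAC.meanC N (1 / N) φ = 0 →
      Real.sqrt (MAC.normC2 N (1 / N) φ)
        ≤ C₀ * Real.sqrt (MAC.gnormC2 N (1 / N) φ) := by
  refine ⟨1, one_pos, fun N hN φ hφ => ?_⟩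
  rw [one_mul]
  exact Real.sqrt_le_sqrt (MAC.normC2_le_gnormC2 (by omega) φ hφ)
end

section
/- There exists a constant C₁ > 0, independent of the grid resolution, such that for every integer N ≥ 2 (h = 1/N) and every cell-centered grid function φ with zero discrete mean h² Σ_{i,j} φ_{i+1/2,j+1/2} = 0, the discrete Sobolev interpolation inequality ‖φ‖_∞ ≤ C₁ ‖φ‖₂^{2/3} · ‖∇_h Δ_h φ‖₂^{1/3} holds, where Δ_h φ is the five-point discrete Laplacian (using the Neumann ghost extension) and ∇_h Δ_h φ its discrete gradient (again with Neumann ghost extension of Δ_h φ). -/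
namespace MAC

open Finset

/-! ### Finite sums in one variable -/

/-- Summation by parts, with boundary terms. -/
theorem sum_diff_mul_add_sum_mul_diff (g v : ℤ → ℝ) (n : ℕ) :
    ∑ i ∈ range n, (g (i + 1) - g i) * v i
      + ∑ i ∈ range (n + 1), g i * (v i - v (i - 1)) = g n * v n - g 0 * v (-1) := by
  induction n with
  | zero => simp; ring
  | succ n ih =>
    rw [sum_range_succ, sum_range_succ _ (n + 1)]
    push_cast
    rw [add_sub_cancel_right]
    linear_combination ih

theorem sum_diff_mul_of_boundary (g v : ℤ → ℝ) (n : ℕ) (h0 : g 0 = 0) (hn : g n = 0) :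
    ∑ i ∈ range n, (g (i + 1) - g i) * v i
      = -∑ i ∈ range (n + 1), g i * (v i - v (i - 1)) := by
  have := sum_diff_mul_add_sum_mul_diff g v n
  rw [h0, hn] at this
  linarith

theorem abs_sub_le_sum_abs_diff (f : ℤ → ℝ) (n k l : ℕ) (hk : k ≤ n) (hl : l ≤ n) :
    |f k - f l| ≤ ∑ i ∈ range n, |f (i + 1) - f i| := by
  induction n generalizing k l with
  | zero =>
    obtain rfl : k = 0 := by omega
    obtain rfl : l = 0 := by omega
    simp
  | succ n ih =>
    rw [sum_range_succ]
    have hd := abs_nonneg (f (n + 1) - f n)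
    rcases Nat.lt_or_ge n k with hk' | hk' <;> rcases Nat.lt_or_ge n l with hl' | hl'
    · obtain rfl : k = n + 1 := by omega
      obtain rfl : l = n + 1 := by omega
      have : 0 ≤ ∑ i ∈ range n, |f (i + 1) - f i| := sum_nonneg fun _ _ => abs_nonneg _
      rw [sub_self, abs_zero]
      linarith
    · obtain rfl : k = n + 1 := by omega
      have h1 := ih n l le_rfl hl'
      have h2 := abs_sub_le (f (n + 1)) (f n) (f l)
      push_cast
      linarith
    · obtain rfl : l = n + 1 := by omega
      have h1 := ih k n hk' le_rfl
      have h2 := abs_sub_le (f k) (f n) (f (n + 1))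
      rw [abs_sub_comm (f n) (f (n + 1))] at h2
      push_cast
      linarith
    · linarith [ih k l hk' hl']

theorem sum_shift_le (g : ℤ → ℝ) (hg : ∀ i, 0 ≤ g i) (n : ℕ) :
    ∑ i ∈ range n, g (i + 1) ≤ ∑ i ∈ range (n + 1), g i := by
  rw [sum_range_succ']
  push_cast
  linarith [hg 0]

theorem sum_sq_diff_shift_le (f : ℤ → ℝ) (n : ℕ) :
    ∑ i ∈ range n, (f (i + 1) - f i) ^ 2
      ≤ ∑ i ∈ range (n + 1 + 1), (f i - f (i - 1)) ^ 2 := by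
  have h := sum_shift_le (fun i => (f i - f (i - 1)) ^ 2) (fun _ => sq_nonneg _) n
  simp only [add_sub_cancel_right] at h
  rw [sum_range_succ]
  linarith [sq_nonneg (f ((n + 1 : ℕ) : ℤ) - f (((n + 1 : ℕ) : ℤ) - 1))]

/-- One-dimensional discrete trace inequality, in the form produced by Young's inequality. -/
theorem sq_le_trace (f : ℤ → ℝ) (N : ℕ) (t : ℝ) (ht : 0 < t) (k : ℕ) (hk : k < N) :
    f k ^ 2 ≤ (1 / N + t) * ∑ i ∈ range N, f i ^ 2
      + (1 / t) * ∑ i ∈ range (N + 1), (f i - f (i - 1)) ^ 2 := by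
  obtain ⟨n, rfl⟩ : ∃ n, N = n + 1 := ⟨N - 1, by omega⟩
  set F := ∑ i ∈ range (n + 1), f i ^ 2 with hF
  set D := ∑ i ∈ range (n + 1 + 1), (f i - f (i - 1)) ^ 2
  have hNpos : (0 : ℝ) < (n + 1 : ℕ) := by positivity
  have hvar : ∑ i ∈ range n, |f (i + 1) ^ 2 - f i ^ 2| ≤ t * F + 1 / t * D := by
    have hterm : ∀ i ∈ range n, |f (i + 1) ^ 2 - f i ^ 2|
        ≤ 1 / t * (f (i + 1) - f i) ^ 2 + t / 2 * f (i + 1) ^ 2 + t / 2 * f i ^ 2 := by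
      intro i _
      have key : ∀ a b : ℝ, a ^ 2 - b ^ 2
          ≤ 1 / t * (a - b) ^ 2 + t / 2 * a ^ 2 + t / 2 * b ^ 2 := by
        intro a b
        have h1 : 1 / t * (a - b) ^ 2 + t / 2 * a ^ 2 + t / 2 * b ^ 2 - (a ^ 2 - b ^ 2)
            = 1 / t * ((a - b) - t / 2 * (a + b)) ^ 2 + t / 4 * (a - b) ^ 2 := by
          field_simp
          ring
        have h2 : 0 ≤ 1 / t * ((a - b) - t / 2 * (a + b)) ^ 2 + t / 4 * (a - b) ^ 2 := by
          positivity
        linarith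
      rw [abs_le]
      constructor
      · linarith [key (f i) (f (i + 1)), sub_sq_comm (f i) (f (i + 1))]
      · exact key _ _
    refine (sum_le_sum hterm).trans ?_
    rw [sum_add_distrib, sum_add_distrib, ← mul_sum, ← mul_sum, ← mul_sum]
    have h1 := sum_sq_diff_shift_le f n
    have h2 := sum_shift_le (fun i => f i ^ 2) (fun _ => sq_nonneg _) n
    have h3 : ∑ i ∈ range n, f i ^ 2 ≤ F := by
      rw [hF, sum_range_succ]
      linarith [sq_nonneg (f n)]
    have h4 := mul_le_mul_of_nonneg_left h1 (by positivity : 0 ≤ 1 / t)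
    have h5 := mul_le_mul_of_nonneg_left h2 (by positivity : 0 ≤ t / 2)
    have h6 := mul_le_mul_of_nonneg_left h3 (by positivity : 0 ≤ t / 2)
    linarith
  have hpt : ∀ l ∈ range (n + 1), f k ^ 2 - (t * F + 1 / t * D) ≤ f l ^ 2 := by
    intro l hl
    have h1 := abs_sub_le_sum_abs_diff (fun i => f i ^ 2) n k l (by omega)
      (by have := mem_range.1 hl; omega)
    have h2 := le_abs_self (f k ^ 2 - f l ^ 2)
    linarith
  have hsum := card_nsmul_le_sum _ _ _ hpt
  rw [card_range, nsmul_eq_mul] at hsum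
  have hdiv : f k ^ 2 - (t * F + 1 / t * D) ≤ 1 / ((n + 1 : ℕ) : ℝ) * F := by
    rw [one_div_mul_eq_div (((n + 1 : ℕ) : ℝ)) F, le_div_iff₀ hNpos]
    linarith
  linarith

/-- One-dimensional discrete Poincaré inequality, keeping the mean. -/
theorem poincare_one_dim (f : ℤ → ℝ) (N : ℕ) :
    N * ∑ i ∈ range N, f i ^ 2 ≤ (∑ i ∈ range N, f i) ^ 2
      + N ^ 3 * ∑ i ∈ range (N + 1), (f i - f (i - 1)) ^ 2 := by
  rcases N with _ | n
  · simp
  set D := ∑ i ∈ range (n + 1 + 1), (f i - f (i - 1)) ^ 2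
  have hD0 : 0 ≤ D := sum_nonneg fun _ _ => sq_nonneg _
  have hpair : ∀ k ∈ range (n + 1), ∀ l ∈ range (n + 1),
      (f k - f l) ^ 2 ≤ ((n + 1 : ℕ) : ℝ) * D := by
    intro k hk l hl
    have h1 := abs_sub_le_sum_abs_diff f n k l (by have := mem_range.1 hk; omega)
      (by have := mem_range.1 hl; omega)
    have h2 : (f k - f l) ^ 2 ≤ (∑ i ∈ range n, |f (i + 1) - f i|) ^ 2 := by
      rw [← sq_abs]
      exact pow_le_pow_left₀ (abs_nonneg _) h1 2
    have h3 := sq_sum_le_card_mul_sum_sq (s := range n) (f := fun i : ℕ => |f (i + 1) - f i|)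
    simp only [sq_abs, card_range] at h3
    have h4 := sum_sq_diff_shift_le f n
    have h5 := mul_le_mul_of_nonneg_left h4 (by positivity : (0 : ℝ) ≤ n)
    push_cast
    linarith
  have hle : ∑ k ∈ range (n + 1), ∑ l ∈ range (n + 1), (f k - f l) ^ 2
      ≤ ∑ k ∈ range (n + 1), ∑ l ∈ range (n + 1), ((n + 1 : ℕ) : ℝ) * D :=
    sum_le_sum fun k hk => sum_le_sum fun l hl => hpair k hk l hl
  have heq : ∑ k ∈ range (n + 1), ∑ l ∈ range (n + 1), (f k - f l) ^ 2
      = 2 * (((n + 1 : ℕ) : ℝ) * ∑ i ∈ range (n + 1), f i ^ 2)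
        - 2 * (∑ i ∈ range (n + 1), f i) ^ 2 := by
    simp only [sub_sq, sum_add_distrib, sum_sub_distrib, sum_const, card_range, nsmul_eq_mul,
      ← mul_sum, ← sum_mul]
    ring
  rw [heq] at hle
  simp only [sum_const, card_range, nsmul_eq_mul] at hle
  have : 0 ≤ ((n + 1 : ℕ) : ℝ) ^ 3 * D := by positivity
  nlinarith

/-! ### Unscaled difference operators on the two-dimensional grid -/

/-- Unscaled backward difference in the first index. -/
def diffX (u : ℤ → ℤ → ℝ) (i j : ℤ) : ℝ := u i j - u (i - 1) j

/-- Unscaled backward difference in the second index. -/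
def diffY (u : ℤ → ℤ → ℝ) (i j : ℤ) : ℝ := u i j - u i (j - 1)

/-- Unscaled second difference in the first index. -/
def diffXX (u : ℤ → ℤ → ℝ) (i j : ℤ) : ℝ := diffX u (i + 1) j - diffX u i j

/-- Unscaled second difference in the second index. -/
def diffYY (u : ℤ → ℤ → ℝ) (i j : ℤ) : ℝ := diffY u i (j + 1) - diffY u i j

/-- Unscaled five-point Laplacian. -/
def diffLap (u : ℤ → ℤ → ℝ) (i j : ℤ) : ℝ := diffXX u i j + diffYY u i j

/-- Sum over the cells of the grid. -/
def sumCell (N : ℕ) (f : ℤ → ℤ → ℝ) : ℝ := ∑ i ∈ range N, ∑ j ∈ range N, f i j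

/-- Sum over the east-west edge points of the grid. -/
def sumEdgeX (N : ℕ) (f : ℤ → ℤ → ℝ) : ℝ := ∑ i ∈ range (N + 1), ∑ j ∈ range N, f i j

/-- Sum over the north-south edge points of the grid. -/
def sumEdgeY (N : ℕ) (f : ℤ → ℤ → ℝ) : ℝ := ∑ i ∈ range N, ∑ j ∈ range (N + 1), f i j

/-- Unscaled squared norm of a cell-centered function. -/
def cellSq (N : ℕ) (u : ℤ → ℤ → ℝ) : ℝ := sumCell N fun i j => u i j ^ 2

/-- Unscaled Dirichlet energy. -/
def dirichlet (N : ℕ) (u : ℤ → ℤ → ℝ) : ℝ :=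
  sumEdgeX N (fun i j => diffX u i j ^ 2) + sumEdgeY N fun i j => diffY u i j ^ 2

/-- Discrete homogeneous Neumann condition for a function on the whole index plane. -/
structure Neumann (N : ℕ) (u : ℤ → ℤ → ℝ) : Prop where
  west : ∀ j, diffX u 0 j = 0
  east : ∀ j, diffX u N j = 0
  south : ∀ i, diffY u i 0 = 0
  north : ∀ i, diffY u i N = 0

theorem cellSq_nonneg (N : ℕ) (u : ℤ → ℤ → ℝ) : 0 ≤ cellSq N u := by
  simp only [cellSq, sumCell]
  exact sum_nonneg fun _ _ => sum_nonneg fun _ _ => sq_nonneg _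

theorem dirichlet_nonneg (N : ℕ) (u : ℤ → ℤ → ℝ) : 0 ≤ dirichlet N u :=
  add_nonneg (sum_nonneg fun _ _ => sum_nonneg fun _ _ => sq_nonneg _)
    (sum_nonneg fun _ _ => sum_nonneg fun _ _ => sq_nonneg _)

/-- Discrete Green identity. -/
theorem sumCell_diffLap_mul {N : ℕ} {u : ℤ → ℤ → ℝ} (hu : Neumann N u) (v : ℤ → ℤ → ℝ) :
    sumCell N (fun i j => diffLap u i j * v i j)
      = -(sumEdgeX N (fun i j => diffX u i j * diffX v i j)
          + sumEdgeY N fun i j => diffY u i j * diffY v i j) := by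
  have hx : ∑ i ∈ range N, ∑ j ∈ range N, diffXX u i j * v i j
      = -∑ i ∈ range (N + 1), ∑ j ∈ range N, diffX u i j * diffX v i j := by
    rw [sum_comm, sum_comm (s := range (N + 1)), ← sum_neg_distrib]
    exact sum_congr rfl fun j _ => sum_diff_mul_of_boundary (fun i => diffX u i j)
      (fun i => v i j) N (hu.west j) (hu.east j)
  have hy : ∑ i ∈ range N, ∑ j ∈ range N, diffYY u i j * v i j
      = -∑ i ∈ range N, ∑ j ∈ range (N + 1), diffY u i j * diffY v i j := by
    rw [← sum_neg_distrib]
    exact sum_congr rfl fun i _ => sum_diff_mul_of_boundary (diffY u i) (v i) N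
      (hu.south i) (hu.north i)
  simp only [sumCell, sumEdgeX, sumEdgeY, diffLap, add_mul, sum_add_distrib, hx, hy]
  ring

/-- Cauchy–Schwarz for double sums. -/
theorem sq_sum_sum_mul_le (s t : Finset ℕ) (f g : ℤ → ℤ → ℝ) :
    (∑ i ∈ s, ∑ j ∈ t, f i j * g i j) ^ 2
      ≤ (∑ i ∈ s, ∑ j ∈ t, f i j ^ 2) * ∑ i ∈ s, ∑ j ∈ t, g i j ^ 2 := by
  simp only [← sum_product']
  exact sum_mul_sq_le_sq_mul_sq (s ×ˢ t) (fun p => f p.1 p.2) (fun p => g p.1 p.2)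

/-- Interpolation of the Dirichlet energy between the function and its Laplacian. -/
theorem dirichlet_sq_le {N : ℕ} {u : ℤ → ℤ → ℝ} (hu : Neumann N u) :
    dirichlet N u ^ 2 ≤ cellSq N u * cellSq N (diffLap u) := by
  have h := sumCell_diffLap_mul hu u
  have hcs := sq_sum_sum_mul_le (range N) (range N) (diffLap u) u
  have hG : dirichlet N u = -sumCell N fun i j => diffLap u i j * u i j := by
    rw [h]
    simp only [dirichlet, sq, neg_neg]
  rw [hG, neg_sq, mul_comm (cellSq N u)]
  exact hcs

/-- Interpolation of the Laplacian between the gradient of the function and that of any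
function agreeing with the Laplacian on the cells. -/
theorem cellSq_diffLap_sq_le {N : ℕ} {u w : ℤ → ℤ → ℝ} (hu : Neumann N u)
    (hw : ∀ i ∈ range N, ∀ j ∈ range N, w i j = diffLap u i j) :
    cellSq N (diffLap u) ^ 2 ≤ dirichlet N u * dirichlet N w := by
  have h := sumCell_diffLap_mul hu w
  have hL : cellSq N (diffLap u) = sumCell N fun i j => diffLap u i j * w i j := by
    simp only [cellSq, sumCell]
    exact sum_congr rfl fun i hi => sum_congr rfl fun j hj => by rw [hw i hi j hj, sq]
  rw [hL, h, neg_sq]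
  have hx := sq_sum_sum_mul_le (range (N + 1)) (range N) (diffX u) (diffX w)
  have hy := sq_sum_sum_mul_le (range N) (range (N + 1)) (diffY u) (diffY w)
  have cauchy : ∀ {p q a b c d : ℝ}, 0 ≤ a → 0 ≤ b → 0 ≤ c → 0 ≤ d → p ^ 2 ≤ a * c →
      q ^ 2 ≤ b * d → (p + q) ^ 2 ≤ (a + b) * (c + d) := by
    intro p q a b c d ha hb hc hd hp hq
    have hpq : (2 * (p * q)) ^ 2 ≤ (a * d + b * c) ^ 2 := by
      have h1 : p ^ 2 * q ^ 2 ≤ (a * c) * (b * d) :=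
        mul_le_mul hp hq (sq_nonneg _) (mul_nonneg ha hc)
      nlinarith [sq_nonneg (a * d - b * c)]
    have h2 := abs_le_of_sq_le_sq' hpq (by positivity)
    nlinarith [h2.2]
  have nn : ∀ (s t : Finset ℕ) (f : ℤ → ℤ → ℝ), 0 ≤ ∑ i ∈ s, ∑ j ∈ t, f i j ^ 2 :=
    fun _ _ _ => sum_nonneg fun _ _ => sum_nonneg fun _ _ => sq_nonneg _
  exact cauchy (nn _ _ _) (nn _ _ _) (nn _ _ _) (nn _ _ _) hx hy

/-- The mixed second differences are controlled by the Laplacian. -/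
theorem two_mul_sum_mixed_le {N : ℕ} {u : ℤ → ℤ → ℝ} (hu : Neumann N u) :
    2 * ∑ i ∈ range (N + 1), ∑ j ∈ range (N + 1), diffX (diffY u) i j ^ 2
      ≤ cellSq N (diffLap u) := by
  have hx : ∑ i ∈ range N, ∑ j ∈ range N, diffXX u i j * diffYY u i j
      = -∑ i ∈ range (N + 1), ∑ j ∈ range N, diffX u i j * diffX (diffYY u) i j := by
    rw [sum_comm, sum_comm (s := range (N + 1)), ← sum_neg_distrib]
    exact sum_congr rfl fun j _ => sum_diff_mul_of_boundary (fun i => diffX u i j)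
      (fun i => diffYY u i j) N (hu.west j) (hu.east j)
  have hy : ∑ i ∈ range (N + 1), ∑ j ∈ range N, diffX u i j * diffX (diffYY u) i j
      = -∑ i ∈ range (N + 1), ∑ j ∈ range (N + 1), diffX (diffY u) i j ^ 2 := by
    rw [← sum_neg_distrib]
    refine sum_congr rfl fun i _ => ?_
    have h := sum_diff_mul_of_boundary (diffX (diffY u) i) (diffX u i) N
      (by simp [diffX, hu.south]) (by simp [diffX, hu.north])
    have h1 : ∑ j ∈ range N, diffX u i j * diffX (diffYY u) i j
        = ∑ j ∈ range N, (diffX (diffY u) i (j + 1) - diffX (diffY u) i j) * diffX u i j :=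
      sum_congr rfl fun j _ => by simp only [diffX, diffYY]; ring
    rw [h1, h]
    congr 1
    exact sum_congr rfl fun j _ => by simp only [diffX, diffY]; ring
  rw [hy, neg_neg] at hx
  rw [← hx]
  simp only [cellSq, sumCell, mul_sum]
  refine sum_le_sum fun i _ => sum_le_sum fun j _ => ?_
  simp only [diffLap]
  nlinarith [sq_nonneg (diffXX u i j), sq_nonneg (diffYY u i j)]

/-- Discrete Poincaré inequality for functions of zero mean. -/
theorem cellSq_le_dirichlet {N : ℕ} (hN : 0 < N) {u : ℤ → ℤ → ℝ}
    (hmean : sumCell N u = 0) : cellSq N u ≤ N ^ 2 * dirichlet N u := by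
  have hN' : (0 : ℝ) < N := by exact_mod_cast hN
  set R := ∑ i ∈ range N, (∑ j ∈ range N, u i j) ^ 2 with hR
  set X := sumEdgeX N fun i j => diffX u i j ^ 2 with hX
  set Y := sumEdgeY N fun i j => diffY u i j ^ 2 with hY
  have hrow : N * cellSq N u ≤ R + N ^ 3 * Y := by
    rw [cellSq, sumCell, hR, hY, sumEdgeY, mul_sum, mul_sum, ← sum_add_distrib]
    exact sum_le_sum fun i _ => poincare_one_dim (u i) N
  have hcol := poincare_one_dim (fun i => ∑ j ∈ range N, u i j) N
  have hd : ∑ i ∈ range (N + 1), (∑ j ∈ range N, u i j - ∑ j ∈ range N, u (i - 1) j) ^ 2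
      ≤ N * X := by
    rw [hX, sumEdgeX, mul_sum]
    refine sum_le_sum fun i _ => ?_
    rw [← sum_sub_distrib]
    have h := sq_sum_le_card_mul_sum_sq (s := range N) (f := fun j : ℕ => diffX u i j)
    rw [card_range] at h
    exact h
  have hmean' : ∑ i ∈ range N, ∑ j ∈ range N, u i j = 0 := hmean
  simp only [hmean'] at hcol
  have hRX : R ≤ N ^ 3 * X := by
    have h1 := mul_le_mul_of_nonneg_left hd (by positivity : (0 : ℝ) ≤ N ^ 3)
    refine le_of_mul_le_mul_left ?_ hN'
    calc N * R ≤ 0 ^ 2 + N ^ 3 * _ := hcol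
      _ ≤ N ^ 3 * (N * X) := by linarith
      _ = N * (N ^ 3 * X) := by ring
  refine le_of_mul_le_mul_left ?_ hN'
  calc N * cellSq N u ≤ N ^ 3 * X + N ^ 3 * Y := by linarith
    _ = N * (N ^ 2 * dirichlet N u) := by simp only [dirichlet]; ring

/-- Two-dimensional trace inequality with a free parameter. -/
theorem sq_le_trace_two_dim (N : ℕ) (u : ℤ → ℤ → ℝ) (t : ℝ) (ht : 0 < t) (k l : ℕ)
    (hk : k < N) (hl : l < N) :
    u k l ^ 2 ≤ (1 / N + t) ^ 2 * cellSq N u + (1 / N + t) * (1 / t) * dirichlet N u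
      + (1 / t) ^ 2
        * ∑ i ∈ range (N + 1), ∑ j ∈ range (N + 1), diffX (diffY u) i j ^ 2 := by
  have hu : ∑ j ∈ range N, u k j ^ 2 ≤ (1 / N + t) * cellSq N u
      + (1 / t) * sumEdgeX N fun i j => diffX u i j ^ 2 := by
    rw [cellSq, sumCell, sumEdgeX, sum_comm, sum_comm (s := range (N + 1)), mul_sum, mul_sum,
      ← sum_add_distrib]
    exact sum_le_sum fun j _ => sq_le_trace (fun i => u i j) N t ht k hk
  have hd : ∑ j ∈ range (N + 1), diffY u k j ^ 2
      ≤ (1 / N + t) * (sumEdgeY N fun i j => diffY u i j ^ 2)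
        + (1 / t)
          * ∑ i ∈ range (N + 1), ∑ j ∈ range (N + 1), diffX (diffY u) i j ^ 2 := by
    rw [sumEdgeY, sum_comm, sum_comm (s := range (N + 1)) (t := range (N + 1)), mul_sum, mul_sum,
      ← sum_add_distrib]
    exact sum_le_sum fun j _ => sq_le_trace (fun i => diffY u i j) N t ht k hk
  have h := sq_le_trace (u k) N t ht l hl
  have h1 := mul_le_mul_of_nonneg_left hu (by positivity : 0 ≤ 1 / (N : ℝ) + t)
  have h2 := mul_le_mul_of_nonneg_left hd (by positivity : 0 ≤ 1 / t)
  calc u k l ^ 2 ≤ _ := h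
    _ ≤ _ := add_le_add h1 h2
    _ = _ := by simp only [dirichlet]; ring

/-- Unscaled form of the Sobolev interpolation inequality. -/
theorem pow_six_le {N : ℕ} {u w : ℤ → ℤ → ℝ} (hu : Neumann N u)
    (hw : ∀ i ∈ range N, ∀ j ∈ range N, w i j = diffLap u i j)
    (hmean : sumCell N u = 0) (k l : ℕ) (hk : k < N) (hl : l < N) :
    u k l ^ 6 ≤ 4 ^ 6 * (cellSq N u ^ 2 * dirichlet N w) := by
  have hN : 0 < N := by omega
  have hN' : (0 : ℝ) < N := by exact_mod_cast hN
  set S := cellSq N u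
  set G := dirichlet N u
  set L := cellSq N (diffLap u) with hL
  set T := dirichlet N w
  have hS0 : 0 ≤ S := cellSq_nonneg _ _
  have hG0 : 0 ≤ G := dirichlet_nonneg _ _
  have hL0 : 0 ≤ L := cellSq_nonneg _ _
  have hT0 : 0 ≤ T := dirichlet_nonneg _ _
  have hGS : G ^ 2 ≤ S * L := dirichlet_sq_le hu
  have hLG : L ^ 2 ≤ G * T := cellSq_diffLap_sq_le hu hw
  have hP : S ≤ N ^ 2 * G := cellSq_le_dirichlet hN hmean
  have hM := two_mul_sum_mixed_le hu
  rw [← hL] at hM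
  rcases hS0.eq_or_lt with h0 | hSpos
  · have hle : u k l ^ 2 ≤ S := by
      have h1 : u k l ^ 2 ≤ ∑ j ∈ range N, u k j ^ 2 :=
        single_le_sum (f := fun j : ℕ => u k j ^ 2) (fun _ _ => sq_nonneg _) (mem_range.2 hl)
      exact h1.trans (single_le_sum (f := fun i : ℕ => ∑ j ∈ range N, u i j ^ 2)
        (fun _ _ => sum_nonneg fun _ _ => sq_nonneg _) (mem_range.2 hk))
    have hz : u k l = 0 := by
      rw [← h0] at hle
      exact pow_eq_zero_iff two_ne_zero |>.1 (le_antisymm hle (sq_nonneg _))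
    rw [hz, ← h0]
    simp
  have hGpos : 0 < G := by
    by_contra hcon
    have : G = 0 := le_antisymm (not_lt.1 hcon) hG0
    rw [this] at hP
    linarith
  have hLpos : 0 < L := by
    by_contra hcon
    have : L = 0 := le_antisymm (not_lt.1 hcon) hL0
    rw [this] at hGS
    nlinarith
  obtain ⟨t, ht, htL⟩ : ∃ t : ℝ, 0 < t ∧ t ^ 4 * S = L := by
    refine ⟨√√(L / S), by positivity, ?_⟩
    have h1 : √√(L / S) ^ 4 = L / S := by
      rw [show (4 : ℕ) = 2 * 2 from rfl, pow_mul, Real.sq_sqrt (by positivity),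
        Real.sq_sqrt (by positivity)]
    rw [h1, div_mul_cancel₀ _ hSpos.ne']
  have hGt : G ≤ t ^ 2 * S := by
    refine abs_le_of_sq_le_sq' ?_ (by positivity) |>.2
    calc G ^ 2 ≤ S * L := hGS
      _ = (t ^ 2 * S) ^ 2 := by rw [← htL]; ring
  have hNt : 1 / (N : ℝ) ≤ t := by
    rw [div_le_iff₀ hN']
    have h1 : 1 * S ≤ (t * N) ^ 2 * S := by
      have := mul_le_mul_of_nonneg_left hGt (by positivity : (0 : ℝ) ≤ N ^ 2)
      linarith
    have h2 : (1 : ℝ) ^ 2 ≤ (t * N) ^ 2 := by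
      rw [one_pow]
      exact le_of_mul_le_mul_right h1 hSpos
    exact abs_le_of_sq_le_sq' h2 (by positivity) |>.2
  have hu2 : u k l ^ 2 ≤ 16 * (t ^ 2 * S) := by
    have h := sq_le_trace_two_dim N u t ht k l hk hl
    have ha : 1 / (N : ℝ) + t ≤ 2 * t := by linarith
    have ha0 : 0 ≤ 1 / (N : ℝ) + t := by positivity
    have h1 : (1 / (N : ℝ) + t) ^ 2 * S ≤ (2 * t) ^ 2 * S :=
      mul_le_mul_of_nonneg_right (pow_le_pow_left₀ ha0 ha 2) hS0
    have h2 : (1 / (N : ℝ) + t) * (1 / t) * G ≤ 2 * (t ^ 2 * S) := by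
      refine mul_le_mul ?_ hGt hG0 zero_le_two
      rw [mul_one_div, div_le_iff₀ ht]
      exact ha
    have h3 : (1 / t) ^ 2
        * ∑ i ∈ range (N + 1), ∑ j ∈ range (N + 1), diffX (diffY u) i j ^ 2
          ≤ t ^ 2 * S := by
      calc _ ≤ (1 / t) ^ 2 * L := mul_le_mul_of_nonneg_left (by linarith) (by positivity)
        _ = t ^ 2 * S := by rw [← htL]; field_simp
    nlinarith [mul_pos (pow_pos ht 2) hSpos]
  have hTt : t ^ 6 * S ≤ T := by
    have h1 : L ^ 2 ≤ t ^ 2 * S * T := hLG.trans (mul_le_mul_of_nonneg_right hGt hT0)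
    refine le_of_mul_le_mul_left ?_ (by positivity : 0 < t ^ 2 * S)
    calc t ^ 2 * S * (t ^ 6 * S) = L ^ 2 := by rw [← htL]; ring
      _ ≤ _ := h1
  calc u k l ^ 6 = (u k l ^ 2) ^ 3 := by ring
    _ ≤ (16 * (t ^ 2 * S)) ^ 3 := pow_le_pow_left₀ (sq_nonneg _) hu2 3
    _ = 4 ^ 6 * (S ^ 2 * (t ^ 6 * S)) := by ring
    _ ≤ _ := by gcongr

/-! ### Transfer to the scaled operators -/

theorem cl_of_lt_s8 {N i : ℕ} (hi : i < N) : cl N i = i := by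
  simp only [cl]
  omega

theorem extC_of_mem {N : ℕ} (f : ℤ → ℤ → ℝ) {i j : ℕ} (hi : i ∈ range N) (hj : j ∈ range N) :
    extC N f i j = f i j := by
  rw [extC, cl_of_lt_s8 (mem_range.1 hi), cl_of_lt_s8 (mem_range.1 hj)]

theorem neumann_extC {N : ℕ} (hN : 0 < N) (f : ℤ → ℤ → ℝ) : Neumann N (extC N f) := by
  have h0 : cl N (0 - 1) = cl N 0 := by simp only [cl]; omega
  have hN' : cl N ((N : ℤ) - 1) = cl N N := by simp only [cl]; omega
  constructor <;> intro _ <;> simp only [diffX, diffY, extC, h0, hN', sub_self]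

theorem lapC_eq_diffLap (N : ℕ) (f : ℤ → ℤ → ℝ) (i j : ℤ) :
    lapC N (1 / N) f i j = (N : ℝ) ^ 2 * diffLap (extC N f) i j := by
  simp only [lapC, diffLap, diffXX, diffYY, diffX, diffY, add_sub_cancel_right, one_div, inv_pow,
    div_inv_eq_mul]
  ring

theorem normC2_eq_cellSq (N : ℕ) (f : ℤ → ℤ → ℝ) :
    normC2 N (1 / N) f = (1 / (N : ℝ)) ^ 2 * cellSq N (extC N f) := by
  rw [normC2, ipC, cellSq, sumCell]
  congr 1
  exact sum_congr rfl fun i hi => sum_congr rfl fun j hj => by rw [extC_of_mem f hi hj, sq]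

theorem gnormC2_lapC_eq_dirichlet {N : ℕ} (hN : 0 < N) (f : ℤ → ℤ → ℝ) :
    gnormC2 N (1 / N) (lapC N (1 / N) f)
      = (N : ℝ) ^ 4 * dirichlet N (extC N (diffLap (extC N f))) := by
  have hN' : (N : ℝ) ≠ 0 := by exact_mod_cast hN.ne'
  have hext : ∀ i j, extC N (lapC N (1 / N) f) i j
      = (N : ℝ) ^ 2 * extC N (diffLap (extC N f)) i j :=
    fun i j => lapC_eq_diffLap N f (cl N i) (cl N j)
  have hx : ∀ i j, gradX N (1 / N) (lapC N (1 / N) f) i j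
      = (N : ℝ) ^ 3 * diffX (extC N (diffLap (extC N f))) i j := by
    intro i j
    rw [gradX, diffX, hext, hext, one_div, div_inv_eq_mul]
    ring
  have hy : ∀ i j, gradY N (1 / N) (lapC N (1 / N) f) i j
      = (N : ℝ) ^ 3 * diffY (extC N (diffLap (extC N f))) i j := by
    intro i j
    rw [gradY, diffY, hext, hext, one_div, div_inv_eq_mul]
    ring
  simp only [gnormC2, normV2, ipV, hx, hy, dirichlet, sumEdgeX, sumEdgeY, ← sq, mul_pow,
    ← mul_sum]
  field_simp

end MAC

open Finset in
/-- **Discrete Sobolev interpolation inequality**: there is `C₁ > 0`,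
independent of the resolution, with
`‖φ‖_∞ ≤ C₁ ‖φ‖₂^{2/3} ‖∇_h Δ_h φ‖₂^{1/3}` for all zero-mean cell-centered `φ`. -/
theorem discrete_sobolev_Linf :
    ∃ C₁ : ℝ, 0 < C₁ ∧ ∀ N : ℕ, 2 ≤ N → ∀ φ : ℤ → ℤ → ℝ,
      MAC.meanC N (1 / N) φ = 0 →
      ∀ i ∈ range N, ∀ j ∈ range N,
        |φ i j| ≤ C₁ * Real.sqrt (MAC.normC2 N (1 / N) φ) ^ ((2 : ℝ) / 3)
            * Real.sqrt (MAC.gnormC2 N (1 / N)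
                (MAC.lapC N (1 / N) φ)) ^ ((1 : ℝ) / 3) := by
  refine ⟨4, by norm_num, fun N hN φ hmean i hi j hj => ?_⟩
  have hNpos : 0 < N := by omega
  have hN' : (0 : ℝ) < N := by exact_mod_cast hNpos
  have hmean' : MAC.sumCell N (MAC.extC N φ) = 0 := by
    have h : ∑ i ∈ range N, ∑ j ∈ range N, φ i j = 0 :=
      (mul_eq_zero.1 hmean).resolve_left (by positivity)
    rw [← h]
    exact sum_congr rfl fun i hi => sum_congr rfl fun j hj => MAC.extC_of_mem φ hi hj
  have hsix := MAC.pow_six_le (MAC.neumann_extC hNpos φ)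
    (fun i hi j hj => MAC.extC_of_mem (MAC.diffLap (MAC.extC N φ)) hi hj) hmean' i j
    (mem_range.1 hi) (mem_range.1 hj)
  rw [MAC.extC_of_mem φ hi hj] at hsix
  set A := MAC.normC2 N (1 / N) φ with hA
  set B := MAC.gnormC2 N (1 / N) (MAC.lapC N (1 / N) φ) with hB
  rw [MAC.normC2_eq_cellSq] at hA
  rw [MAC.gnormC2_lapC_eq_dirichlet hNpos] at hB
  have hA0 : 0 ≤ A := by
    rw [hA]
    exact mul_nonneg (by positivity) (MAC.cellSq_nonneg _ _)
  have hB0 : 0 ≤ B := by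
    rw [hB]
    exact mul_nonneg (by positivity) (MAC.dirichlet_nonneg _ _)
  have hAB : φ i j ^ 6 ≤ 4 ^ 6 * (A ^ 2 * B) := by
    refine hsix.trans_eq ?_
    rw [hA, hB]
    field_simp
  have hpow : (√A ^ ((2 : ℝ) / 3)) ^ 6 = A ^ 2 := by
    rw [← Real.rpow_natCast, ← Real.rpow_mul (Real.sqrt_nonneg A),
      show (2 : ℝ) / 3 * (6 : ℕ) = ((2 * 2 : ℕ) : ℝ) by norm_num, Real.rpow_natCast, pow_mul,
      Real.sq_sqrt hA0]
  have hpow' : (√B ^ ((1 : ℝ) / 3)) ^ 6 = B := by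
    rw [← Real.rpow_natCast, ← Real.rpow_mul (Real.sqrt_nonneg B),
      show (1 : ℝ) / 3 * (6 : ℕ) = ((2 : ℕ) : ℝ) by norm_num, Real.rpow_natCast,
      Real.sq_sqrt hB0]
  refine le_of_pow_le_pow_left₀ (n := 6) (by norm_num) (by positivity) ?_
  rw [mul_pow, mul_pow, hpow, hpow', Even.pow_abs (by decide), mul_assoc]
  exact hAB
end

section
/- There exists a constant C₀ > 0, independent of the grid resolution, such that for every integer N ≥ 2 (h = 1/N) and every MAC vector grid function v satisfying the discrete no-penetration and free-slip conditions, the discrete Poincaré inequality ‖v‖₂ ≤ C₀ ‖∇_h v‖₂ holds. -/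
/-- One-dimensional discrete Poincaré inequality for a sequence vanishing at the left endpoint. -/
lemma sum_sq_le_sq_mul_sum_sq_sub (N : ℕ) (u : ℕ → ℝ) (hu : u 0 = 0) :
    ∑ i ∈ Finset.range (N + 1), u i * u i
      ≤ (N : ℝ) ^ 2 * ∑ i ∈ Finset.range N, (u (i + 1) - u i) ^ 2 := by
  set S := ∑ i ∈ Finset.range N, (u (i + 1) - u i) ^ 2 with hS
  have hS0 : 0 ≤ S := Finset.sum_nonneg fun i _ => sq_nonneg _
  have pointwise : ∀ n ≤ N, u n * u n ≤ N * S := by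
    intro n hn
    have telescope : u n = ∑ i ∈ Finset.range n, (u (i + 1) - u i) := by
      rw [Finset.sum_range_sub, hu, sub_zero]
    have cauchy := sq_sum_le_card_mul_sum_sq (s := Finset.range n)
      (f := fun i => u (i + 1) - u i)
    rw [← telescope, Finset.card_range] at cauchy
    have mono : ∑ i ∈ Finset.range n, (u (i + 1) - u i) ^ 2 ≤ S :=
      Finset.sum_le_sum_of_subset_of_nonneg (Finset.range_mono hn) fun i _ _ => sq_nonneg _
    calc u n * u n = u n ^ 2 := (sq _).symm
      _ ≤ n * ∑ i ∈ Finset.range n, (u (i + 1) - u i) ^ 2 := cauchy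
      _ ≤ N * S := by gcongr
  rw [Finset.sum_range_succ', hu, mul_zero, add_zero]
  calc ∑ i ∈ Finset.range N, u (i + 1) * u (i + 1)
      ≤ ∑ _i ∈ Finset.range N, N * S :=
        Finset.sum_le_sum fun i hi => pointwise _ (Finset.mem_range.mp hi)
    _ = (N : ℝ) ^ 2 * S := by simp; ring

/-- The squared discrete `L²` norm of a MAC vector with no-penetration boundary values is at most
that of its discrete gradient. -/
lemma normV2_le_gnormV2 {N : ℕ} (hN : N ≠ 0) {vx vy : ℤ → ℤ → ℝ} (hv : MAC.NoPen N vx vy) :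
    MAC.normV2 N (1 / N) vx vy ≤ MAC.gnormV2 N (1 / N) vx vy := by
  have hN' : (N : ℝ) ≠ 0 := Nat.cast_ne_zero.mpr hN
  have hdiv : ∀ x : ℝ, (x / (1 / N)) ^ 2 = (N : ℝ) ^ 2 * x ^ 2 := fun x => by
    field_simp
  have hx : ∑ i ∈ Finset.range (N + 1), ∑ j ∈ Finset.range N, vx i j * vx i j
      ≤ ∑ i ∈ Finset.range N, ∑ j ∈ Finset.range N,
          ((vx (i + 1) j - vx i j) / (1 / N)) ^ 2 := by
    rw [Finset.sum_comm]
    conv_rhs => rw [Finset.sum_comm]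
    refine Finset.sum_le_sum fun j hj => ?_
    have := sum_sq_le_sq_mul_sum_sq_sub N (fun i => vx i j)
      (hv.1 j (by positivity) (by exact_mod_cast Finset.mem_range.mp hj)).1
    simpa only [hdiv, ← Finset.mul_sum, Nat.cast_add, Nat.cast_one] using this
  have hy : ∑ i ∈ Finset.range N, ∑ j ∈ Finset.range (N + 1), vy i j * vy i j
      ≤ ∑ i ∈ Finset.range N, ∑ j ∈ Finset.range N,
          ((vy i (j + 1) - vy i j) / (1 / N)) ^ 2 := by
    refine Finset.sum_le_sum fun i hi => ?_
    have := sum_sq_le_sq_mul_sum_sq_sub N (fun j => vy i j)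
      (hv.2 i (by positivity) (by exact_mod_cast Finset.mem_range.mp hi)).1
    simpa only [hdiv, ← Finset.mul_sum, Nat.cast_add, Nat.cast_one] using this
  have hx' := mul_le_mul_of_nonneg_left hx (sq_nonneg (1 / (N : ℝ)))
  have hy' := mul_le_mul_of_nonneg_left hy (sq_nonneg (1 / (N : ℝ)))
  have tangential_x : 0 ≤ (1 / (N : ℝ)) ^ 2 * ∑ i ∈ Finset.range (N + 1),
      ∑ j ∈ Finset.range (N + 1),
        ((MAC.extX N vx i j - MAC.extX N vx i (j - 1)) / (1 / N)) ^ 2 := by positivity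
  have tangential_y : 0 ≤ (1 / (N : ℝ)) ^ 2 * ∑ i ∈ Finset.range (N + 1),
      ∑ j ∈ Finset.range (N + 1),
        ((MAC.extY N vy i j - MAC.extY N vy (i - 1) j) / (1 / N)) ^ 2 := by positivity
  unfold MAC.normV2 MAC.ipV MAC.gnormV2
  linarith

/-- **Discrete Poincaré inequality** for MAC vectors with no-penetration (and
free-slip) boundary conditions: there is `C₀ > 0`, independent of the
resolution, with `‖v‖₂ ≤ C₀ ‖∇_h v‖₂`. -/
theorem discrete_poincare_vector :
    ∃ C₀ : ℝ, 0 < C₀ ∧ ∀ N : ℕ, 2 ≤ N → ∀ vx vy : ℤ → ℤ → ℝ,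
      MAC.NoPen N vx vy →
      Real.sqrt (MAC.normV2 N (1 / N) vx vy)
        ≤ C₀ * Real.sqrt (MAC.gnormV2 N (1 / N) vx vy) := by
  refine ⟨1, one_pos, fun N hN vx vy hv => ?_⟩
  rw [one_mul]
  exact Real.sqrt_le_sqrt (normV2_le_gnormV2 (by lia) hv)
end

section
/- There exists a constant C₂ > 0, independent of the grid resolution, such that for every integer N ≥ 2 (h = 1/N) and every MAC vector grid function v satisfying the discrete no-penetration and free-slip conditions, the discrete Ladyzhenskaya-type interpolation inequality ‖v‖₄ ≤ C₂ ‖v‖₂^{1/2} · ‖∇_h v‖₂^{1/2} holds. -/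
namespace MAC

open Finset

/-- Two values of a sequence differ by at most its total variation. -/
lemma le_add_sum_abs_sub (g : ℕ → ℝ) {K m n : ℕ} (hm : m ≤ K) (hn : n ≤ K) :
    g m ≤ g n + ∑ k ∈ range K, |g (k + 1) - g k| := by
  have key : ∀ a b : ℕ, a ≤ b → b ≤ K →
      |g a - g b| ≤ ∑ k ∈ range K, |g (k + 1) - g k| := by
    intro a b hab hb
    have h := dist_le_Ico_sum_dist g hab
    rw [Real.dist_eq] at h
    refine h.trans ?_
    simp_rw [dist_comm (g _) (g (_ + 1)), Real.dist_eq]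
    refine sum_le_sum_of_subset_of_nonneg ?_ fun _ _ _ => abs_nonneg _
    intro k hk
    simp only [mem_Ico, mem_range] at hk ⊢
    omega
  rcases le_total m n with h | h
  · linarith [key m n h hn, le_abs_self (g m - g n)]
  · linarith [key n m h hm, neg_le_abs (g n - g m)]

/-- A value of a sequence is at most its mean plus its total variation. -/
lemma le_mean_add_sum_abs_sub (g : ℕ → ℝ) {M m : ℕ} (hm : m ≤ M) :
    g m ≤ (∑ k ∈ range (M + 1), g k) / ((M : ℝ) + 1)
      + ∑ k ∈ range M, |g (k + 1) - g k| := by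
  have h : ∑ _k ∈ range (M + 1), g m ≤
      ∑ k ∈ range (M + 1), (g k + ∑ l ∈ range M, |g (l + 1) - g l|) :=
    sum_le_sum fun k hk => le_add_sum_abs_sub g hm (by simp at hk; omega)
  rw [sum_add_distrib] at h
  simp only [sum_const, card_range, nsmul_eq_mul, Nat.cast_add, Nat.cast_one] at h
  have hM : (0 : ℝ) < (M : ℝ) + 1 := by positivity
  rw [div_add' _ _ _ hM.ne', le_div_iff₀ hM]
  linarith

/-- Cauchy–Schwarz for a sum of differences of squares over a finite set. -/
lemma sq_sum_abs_sq_sub_sq_le {ι : Type*} (s : Finset ι) (a b : ι → ℝ) {S : ℝ}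
    (ha : ∑ x ∈ s, a x ^ 2 ≤ S) (hb : ∑ x ∈ s, b x ^ 2 ≤ S) :
    (∑ x ∈ s, |a x ^ 2 - b x ^ 2|) ^ 2 ≤ 4 * S * ∑ x ∈ s, (a x - b x) ^ 2 := by
  have h := sum_mul_sq_le_sq_mul_sq s (fun x => |a x - b x|) (fun x => |a x + b x|)
  simp only [sq_abs, ← abs_mul] at h
  have hsq : ∀ x, (a x - b x) * (a x + b x) = a x ^ 2 - b x ^ 2 := fun x => by ring
  simp only [hsq] at h
  have hsum : ∑ x ∈ s, (a x + b x) ^ 2 ≤ 4 * S := by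
    calc ∑ x ∈ s, (a x + b x) ^ 2 ≤ ∑ x ∈ s, (2 * a x ^ 2 + 2 * b x ^ 2) :=
          sum_le_sum fun x _ => by nlinarith [sq_nonneg (a x - b x)]
      _ = 2 * ∑ x ∈ s, a x ^ 2 + 2 * ∑ x ∈ s, b x ^ 2 := by
          rw [sum_add_distrib, mul_sum, mul_sum]
      _ ≤ 4 * S := by linarith
  have hD : 0 ≤ ∑ x ∈ s, (a x - b x) ^ 2 := sum_nonneg fun x _ => sq_nonneg _
  nlinarith [mul_le_mul_of_nonneg_left hsum hD]

/-- Unscaled discrete Ladyzhenskaya inequality for a scalar grid function vanishing on the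
side `i = 0`. -/
lemma sum_pow_four_le (M : ℕ) (f : ℕ → ℕ → ℝ) (h0 : ∀ j < M + 1, f 0 j = 0) :
    ∑ i ∈ range (M + 2), ∑ j ∈ range (M + 1), f i j ^ 4 ≤
      16 * (∑ i ∈ range (M + 2), ∑ j ∈ range (M + 1), f i j ^ 2)
        * (∑ i ∈ range (M + 1), ∑ j ∈ range (M + 1), (f (i + 1) j - f i j) ^ 2
          + ∑ i ∈ range (M + 2), ∑ j ∈ range M, (f i (j + 1) - f i j) ^ 2) := by
  set S := ∑ i ∈ range (M + 2), ∑ j ∈ range (M + 1), f i j ^ 2 with hS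
  set X := ∑ i ∈ range (M + 1), ∑ j ∈ range (M + 1), (f (i + 1) j - f i j) ^ 2 with hX
  set Y := ∑ i ∈ range (M + 2), ∑ j ∈ range M, (f i (j + 1) - f i j) ^ 2 with hY
  let A : ℕ → ℝ := fun j => ∑ k ∈ range (M + 1), |f (k + 1) j ^ 2 - f k j ^ 2|
  let V : ℕ → ℝ := fun i => ∑ k ∈ range M, |f i (k + 1) ^ 2 - f i k ^ 2|
  let B : ℕ → ℝ := fun i => (∑ k ∈ range (M + 1), f i k ^ 2) / ((M : ℝ) + 1) + V i
  have hM : (0 : ℝ) < (M : ℝ) + 1 := by positivity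
  have hA : ∀ i < M + 2, ∀ j < M + 1, f i j ^ 2 ≤ A j := by
    intro i hi j hj
    have h := le_add_sum_abs_sub (fun k => f k j ^ 2) (K := M + 1) (m := i) (n := 0)
      (by omega) (by omega)
    simpa [h0 j hj, A] using h
  have hB : ∀ i, ∀ j < M + 1, f i j ^ 2 ≤ B i := fun i j hj =>
    le_mean_add_sum_abs_sub (fun k => f i k ^ 2) (by omega)
  have hA0 : ∀ j, 0 ≤ A j := fun j => sum_nonneg fun _ _ => abs_nonneg _
  have hSA : S ≤ ((M : ℝ) + 2) * ∑ j ∈ range (M + 1), A j := by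
    calc S ≤ ∑ i ∈ range (M + 2), ∑ j ∈ range (M + 1), A j :=
          sum_le_sum fun i hi => sum_le_sum fun j hj =>
            hA i (mem_range.1 hi) j (mem_range.1 hj)
      _ = _ := by simp
  have hQ : ∑ i ∈ range (M + 2), ∑ j ∈ range (M + 1), f i j ^ 4 ≤
      (∑ i ∈ range (M + 2), B i) * ∑ j ∈ range (M + 1), A j := by
    rw [sum_mul_sum]
    refine sum_le_sum fun i hi => sum_le_sum fun j hj => ?_
    have hb := hB i j (mem_range.1 hj)
    calc f i j ^ 4 = f i j ^ 2 * f i j ^ 2 := by ring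
      _ ≤ B i * A j := mul_le_mul hb (hA i (mem_range.1 hi) j (mem_range.1 hj))
          (sq_nonneg _) ((sq_nonneg _).trans hb)
  have hBsum : ∑ i ∈ range (M + 2), B i
      = S / ((M : ℝ) + 1) + ∑ i ∈ range (M + 2), V i := by
    simp only [B, sum_add_distrib, hS, sum_div]
  have hAsq : (∑ j ∈ range (M + 1), A j) ^ 2 ≤ 4 * S * X := by
    have h := sq_sum_abs_sq_sub_sq_le (range (M + 1) ×ˢ range (M + 1))
      (fun p => f (p.1 + 1) p.2) (fun p => f p.1 p.2) (S := S) ?_ ?_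
    · rw [sum_product, sum_product] at h
      rw [sum_comm]
      exact h
    · rw [sum_product, hS, sum_range_succ' _ (M + 1)]
      exact le_add_of_nonneg_right (sum_nonneg fun _ _ => sq_nonneg _)
    · rw [sum_product, hS, sum_range_succ _ (M + 1)]
      exact le_add_of_nonneg_right (sum_nonneg fun _ _ => sq_nonneg _)
  have hVsq : (∑ i ∈ range (M + 2), V i) ^ 2 ≤ 4 * S * Y := by
    have h := sq_sum_abs_sq_sub_sq_le (range (M + 2) ×ˢ range M)
      (fun p => f p.1 (p.2 + 1)) (fun p => f p.1 p.2) (S := S) ?_ ?_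
    · rw [sum_product, sum_product] at h
      exact h
    · rw [sum_product, hS]
      refine sum_le_sum fun i _ => ?_
      rw [sum_range_succ' _ M]
      exact le_add_of_nonneg_right (sq_nonneg _)
    · rw [sum_product, hS]
      refine sum_le_sum fun i _ => ?_
      rw [sum_range_succ _ M]
      exact le_add_of_nonneg_right (sq_nonneg _)
  have hAs0 : 0 ≤ ∑ j ∈ range (M + 1), A j := sum_nonneg fun j _ => hA0 j
  have hS0 : 0 ≤ S := sum_nonneg fun _ _ => sum_nonneg fun _ _ => sq_nonneg _
  have hY0 : 0 ≤ Y := sum_nonneg fun _ _ => sum_nonneg fun _ _ => sq_nonneg _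
  have hX0 : 0 ≤ X := sum_nonneg fun _ _ => sum_nonneg fun _ _ => sq_nonneg _
  rw [hBsum] at hQ
  generalize ∑ j ∈ range (M + 1), A j = a at *
  generalize ∑ i ∈ range (M + 2), V i = b at *
  have hSdiv : S / ((M : ℝ) + 1) ≤ 2 * a := by
    rw [div_le_iff₀ hM]
    nlinarith [mul_nonneg (Nat.cast_nonneg (α := ℝ) M) hAs0]
  refine hQ.trans ((mul_le_mul_of_nonneg_right (add_le_add_left hSdiv b) hAs0).trans ?_)
  nlinarith [sq_nonneg (a - b), mul_nonneg hS0 hX0, mul_nonneg hS0 hY0]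

/-- Differences between adjacent interior cells are controlled by the differences of the
mirror extension. -/
lemma sum_sq_sub_le_sum_sq_clamp (M : ℕ) (g : ℤ → ℝ) :
    ∑ j ∈ range M, (g ((j + 1 : ℕ) : ℤ) - g (j : ℕ)) ^ 2 ≤
      ∑ j ∈ range (M + 1 + 1), (g (cl (M + 1) j) - g (cl (M + 1) ((j : ℤ) - 1))) ^ 2 := by
  rw [sum_range_succ' _ (M + 1), sum_range_succ _ M, add_assoc]
  refine le_add_of_le_of_nonneg (sum_le_sum fun j hj => le_of_eq ?_) (by positivity)
  have hj := mem_range.1 hj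
  have h1 : cl (M + 1) ((j + 1 : ℕ) : ℤ) = ((j + 1 : ℕ) : ℤ) := by
    simp only [cl]; omega
  have h2 : cl (M + 1) (((j + 1 : ℕ) : ℤ) - 1) = (j : ℤ) := by
    simp only [cl]; omega
  rw [h1, h2]

/-- Fourth power form of the discrete Ladyzhenskaya inequality. -/
lemma sum_abs_pow_four_le (N : ℕ) (hN : 0 < N) (vx vy : ℤ → ℤ → ℝ) (hv : NoPen N vx vy) :
    (1 / N : ℝ) ^ 2 * ∑ i ∈ range (N + 1), ∑ j ∈ range N, |vx i j| ^ 4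
      + (1 / N : ℝ) ^ 2 * ∑ i ∈ range N, ∑ j ∈ range (N + 1), |vy i j| ^ 4
      ≤ 16 * normV2 N (1 / N) vx vy * gnormV2 N (1 / N) vx vy := by
  obtain ⟨M, rfl⟩ : ∃ M, N = M + 1 := ⟨N - 1, by omega⟩
  have hx := sum_pow_four_le M (fun i j => vx i j)
    fun j hj => (hv.1 j (by omega) (by omega)).1
  have hy := sum_pow_four_le M (fun j i => vy i j)
    fun i hi => (hv.2 i (by omega) (by omega)).1
  have hxY : ∑ i ∈ range (M + 2), ∑ j ∈ range M,
        (vx i ((j + 1 : ℕ) : ℤ) - vx i (j : ℕ)) ^ 2 ≤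
      ∑ i ∈ range (M + 1 + 1), ∑ j ∈ range (M + 1 + 1),
        (extX (M + 1) vx i j - extX (M + 1) vx i (j - 1)) ^ 2 :=
    sum_le_sum fun i _ => sum_sq_sub_le_sum_sq_clamp M (vx i)
  have hyX : ∑ j ∈ range (M + 2), ∑ i ∈ range M,
        (vy ((i + 1 : ℕ) : ℤ) j - vy (i : ℕ) j) ^ 2 ≤
      ∑ i ∈ range (M + 1 + 1), ∑ j ∈ range (M + 1 + 1),
        (extY (M + 1) vy i j - extY (M + 1) vy (i - 1) j) ^ 2 := by
    rw [sum_comm (s := range (M + 1 + 1)) (t := range (M + 1 + 1))]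
    exact sum_le_sum fun j _ => sum_sq_sub_le_sum_sq_clamp M (fun i => vy i j)
  rw [sum_comm, sum_comm (f := fun j i : ℕ => vy i j ^ 2),
    sum_comm (f := fun j i : ℕ => (vy i (j + 1 : ℕ) - vy i j) ^ 2)] at hy
  have hpow : ∀ x : ℝ, |x| ^ 4 = x ^ 4 := fun x => Even.pow_abs (by decide) x
  have hN0 : ((M + 1 : ℕ) : ℝ) ≠ 0 := by positivity
  simp only [normV2, ipV, gnormV2, hpow, div_pow, ← sum_div, ← pow_two]
  push_cast at hx hy hxY hyX hN0 ⊢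
  generalize ∑ i ∈ range (M + 1 + 1), ∑ j ∈ range (M + 1 + 1),
    (extX (M + 1) vx i j - extX (M + 1) vx i (j - 1)) ^ 2 = GX at *
  generalize ∑ i ∈ range (M + 1 + 1), ∑ j ∈ range (M + 1 + 1),
    (extY (M + 1) vy i j - extY (M + 1) vy (i - 1) j) ^ 2 = GY at *
  have hSx : 0 ≤ ∑ i ∈ range (M + 2), ∑ j ∈ range (M + 1), vx i j ^ 2 := by positivity
  have hSy : 0 ≤ ∑ i ∈ range (M + 1), ∑ j ∈ range (M + 2), vy i j ^ 2 := by positivity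
  have hDx : 0 ≤ ∑ i ∈ range (M + 1), ∑ j ∈ range (M + 1), (vx (i + 1) j - vx i j) ^ 2 := by
    positivity
  have hDy : 0 ≤ ∑ i ∈ range (M + 1), ∑ j ∈ range (M + 1), (vy i (j + 1) - vy i j) ^ 2 := by
    positivity
  have hGX : 0 ≤ GX := le_trans (by positivity) hxY
  have hGY : 0 ≤ GY := le_trans (by positivity) hyX
  have hx' := hx.trans (mul_le_mul_of_nonneg_left (add_le_add_right hxY _)
    (mul_nonneg (by norm_num) hSx))
  have hy' := hy.trans (mul_le_mul_of_nonneg_left (add_le_add_right hyX _)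
    (mul_nonneg (by norm_num) hSy))
  simp only [show M + 1 + 1 = M + 2 from rfl]
  generalize ∑ i ∈ range (M + 2), ∑ j ∈ range (M + 1), vx i j ^ 2 = Sx at *
  generalize ∑ i ∈ range (M + 1), ∑ j ∈ range (M + 2), vy i j ^ 2 = Sy at *
  generalize ∑ i ∈ range (M + 1), ∑ j ∈ range (M + 1), (vx (i + 1) j - vx i j) ^ 2 = Dx at *
  generalize ∑ i ∈ range (M + 1), ∑ j ∈ range (M + 1), (vy i (j + 1) - vy i j) ^ 2 = Dy at *
  have hfin := add_le_add hx' hy'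
  have hcross : 16 * Sx * (Dx + GX) + 16 * Sy * (Dy + GY) ≤
      16 * (Sx + Sy) * (Dx + GX + GY + Dy) := by
    have h1 := mul_nonneg hSx (add_nonneg hGY hDy)
    have h2 := mul_nonneg hSy (add_nonneg hDx hGX)
    linarith
  have := mul_le_mul_of_nonneg_left (hfin.trans hcross)
    (by positivity : (0 : ℝ) ≤ 1 / ((M : ℝ) + 1) ^ 2)
  field_simp at this ⊢
  linarith

end MAC

/-- **Discrete Ladyzhenskaya-type interpolation inequality**: there is
`C₂ > 0`, independent of the resolution, with
`‖v‖₄ ≤ C₂ ‖v‖₂^{1/2} ‖∇_h v‖₂^{1/2}` for every MAC vector `v` with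
no-penetration (and free-slip) boundary conditions. -/
theorem discrete_ladyzhenskaya :
    ∃ C₂ : ℝ, 0 < C₂ ∧ ∀ N : ℕ, 2 ≤ N → ∀ vx vy : ℤ → ℤ → ℝ,
      MAC.NoPen N vx vy →
      MAC.norm4V N (1 / N) vx vy
        ≤ C₂ * Real.sqrt (Real.sqrt (MAC.normV2 N (1 / N) vx vy))
            * Real.sqrt (Real.sqrt (MAC.gnormV2 N (1 / N) vx vy)) := by
  refine ⟨2, two_pos, fun N hN vx vy hv => ?_⟩
  have h := MAC.sum_abs_pow_four_le N (by omega) vx vy hv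
  have hV : 0 ≤ MAC.normV2 N (1 / N) vx vy := by
    simp only [MAC.normV2, MAC.ipV, ← pow_two]
    positivity
  have hG : 0 ≤ MAC.gnormV2 N (1 / N) vx vy := by
    simp only [MAC.gnormV2]
    positivity
  have hsqrt : ∀ x : ℝ, 0 ≤ x → √(√x) ^ 4 = x := fun x hx => by
    rw [show 4 = 2 * 2 from rfl, pow_mul, Real.sq_sqrt (Real.sqrt_nonneg x), Real.sq_sqrt hx]
  have hpow : (2 * √(√(MAC.normV2 N (1 / N) vx vy)) * √(√(MAC.gnormV2 N (1 / N) vx vy))) ^ 4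
      = 16 * MAC.normV2 N (1 / N) vx vy * MAC.gnormV2 N (1 / N) vx vy := by
    rw [mul_pow, mul_pow, hsqrt _ hV, hsqrt _ hG]
    norm_num
  rw [← hpow] at h
  refine (Real.rpow_le_rpow (by positivity) h (by norm_num)).trans_eq ?_
  rw [show (1 : ℝ) / 4 = ((4 : ℕ) : ℝ)⁻¹ by norm_num]
  exact Real.pow_rpow_inv_natCast (by positivity) (by norm_num)
end

section
/- L²-orthogonality of the discrete pressure projection: let ψ be a cell-centered grid function (with the discrete homogeneous Neumann ghost extension), let e be a MAC vector grid function satisfying the discrete no-penetration and free-slip conditions with (∇_h·e)_{i+1/2,j+1/2} = 0 at every cell, let c ∈ ℝ, and set ê := e + c ∇_h ψ. Then ‖ê‖₂² = ‖e‖₂² + ‖ê − e‖₂². -/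
open Finset in
/-- Summation by parts on a one-dimensional staggered grid. -/
theorem MAC.sum_mul_sub_add_sum_mul_sub (f g : ℤ → ℝ) (n : ℕ) :
    ∑ i ∈ range (n + 1), g i * (f i - f (i - 1)) + ∑ i ∈ range n, f i * (g (i + 1) - g i)
      = g n * f n - g 0 * f (-1) := by
  induction n with
  | zero => simp; ring
  | succ n ih =>
    rw [sum_range_succ, sum_range_succ (fun i : ℕ => f i * (g (i + 1) - g i))]
    push_cast
    rw [add_sub_cancel_right]
    linear_combination ih

/-- The divergence is minus the adjoint of the gradient under no-penetration conditions. -/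
theorem MAC.ipV_grad_eq_neg_ipC_div (N : ℕ) (h : ℝ) (ψ ux uy : ℤ → ℤ → ℝ)
    (hbc : MAC.NoPen N ux uy) :
    MAC.ipV N h ux uy (MAC.gradX N h ψ) (MAC.gradY N h ψ)
      = -MAC.ipC N h (MAC.extC N ψ) (MAC.divV h ux uy) := by
  have hx : ∑ i ∈ Finset.range (N + 1), ∑ j ∈ Finset.range N, ux i j * MAC.gradX N h ψ i j
      = -∑ i ∈ Finset.range N, ∑ j ∈ Finset.range N,
          MAC.extC N ψ i j * ((ux (i + 1) j - ux i j) / h) := by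
    rw [Finset.sum_comm (s := Finset.range (N + 1)),
      Finset.sum_comm (s := Finset.range N) (t := Finset.range N), ← Finset.sum_neg_distrib]
    refine Finset.sum_congr rfl fun j hj => ?_
    obtain ⟨h0, h1⟩ := hbc.1 j (by positivity) (by exact_mod_cast Finset.mem_range.1 hj)
    have key := MAC.sum_mul_sub_add_sum_mul_sub (fun i => MAC.extC N ψ i j) (fun i => ux i j) N
    simp only [h0, h1, zero_mul, sub_zero] at key
    simp only [MAC.gradX, ← mul_div_assoc, ← Finset.sum_div]
    rw [eq_neg_of_add_eq_zero_left key, neg_div]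
  have hy : ∑ i ∈ Finset.range N, ∑ j ∈ Finset.range (N + 1), uy i j * MAC.gradY N h ψ i j
      = -∑ i ∈ Finset.range N, ∑ j ∈ Finset.range N,
          MAC.extC N ψ i j * ((uy i (j + 1) - uy i j) / h) := by
    rw [← Finset.sum_neg_distrib]
    refine Finset.sum_congr rfl fun i hi => ?_
    obtain ⟨h0, h1⟩ := hbc.2 i (by positivity) (by exact_mod_cast Finset.mem_range.1 hi)
    have key := MAC.sum_mul_sub_add_sum_mul_sub (fun j => MAC.extC N ψ i j) (fun j => uy i j) N
    simp only [h0, h1, zero_mul, sub_zero] at key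
    simp only [MAC.gradY, ← mul_div_assoc, ← Finset.sum_div]
    rw [eq_neg_of_add_eq_zero_left key, neg_div]
  simp only [MAC.ipV, MAC.ipC, MAC.divV, mul_add, Finset.sum_add_distrib, hx, hy]
  ring

/-- Expansion of the squared norm of `u + c v`. -/
theorem MAC.normV2_add_mul (N : ℕ) (h c : ℝ) (ux uy vx vy : ℤ → ℤ → ℝ) :
    MAC.normV2 N h (fun i j => ux i j + c * vx i j) (fun i j => uy i j + c * vy i j)
      = MAC.normV2 N h ux uy + 2 * c * MAC.ipV N h ux uy vx vy
        + MAC.normV2 N h (fun i j => c * vx i j) (fun i j => c * vy i j) := by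
  have expand (a b : ℝ) : (a + c * b) * (a + c * b)
      = a * a + 2 * c * (a * b) + c * b * (c * b) := by ring
  simp only [MAC.normV2, MAC.ipV, expand, Finset.sum_add_distrib, ← Finset.mul_sum]
  ring

open Finset in
/-- **L²-orthogonality of the discrete pressure projection**: if `e` is a
discretely divergence-free MAC vector with no-penetration (and free-slip)
boundary conditions, `ψ` is cell-centered, and `ê := e + c ∇_h ψ`, then
`‖ê‖₂² = ‖e‖₂² + ‖ê − e‖₂²`. -/
theorem projection_L2_orthogonality (N : ℕ) (hN : 2 ≤ N) (h : ℝ)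
    (hh : h = 1 / N) (ψ ex ey : ℤ → ℤ → ℝ) (c : ℝ)
    (hex hey : ℤ → ℤ → ℝ)
    (hbc : MAC.NoPen N ex ey)
    (hdiv : ∀ i ∈ range N, ∀ j ∈ range N, MAC.divV h ex ey i j = 0)
    (hhex : ∀ i j : ℤ, hex i j = ex i j + c * MAC.gradX N h ψ i j)
    (hhey : ∀ i j : ℤ, hey i j = ey i j + c * MAC.gradY N h ψ i j) :
    MAC.normV2 N h hex hey
      = MAC.normV2 N h ex ey
        + MAC.normV2 N h (fun i j => hex i j - ex i j)
            (fun i j => hey i j - ey i j) := by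
  obtain rfl : hex = fun i j => ex i j + c * MAC.gradX N h ψ i j := funext₂ hhex
  obtain rfl : hey = fun i j => ey i j + c * MAC.gradY N h ψ i j := funext₂ hhey
  have horth : MAC.ipV N h ex ey (MAC.gradX N h ψ) (MAC.gradY N h ψ) = 0 := by
    rw [MAC.ipV_grad_eq_neg_ipC_div N h ψ ex ey hbc, MAC.ipC,
      sum_eq_zero fun i hi => sum_eq_zero fun j hj => by rw [hdiv i hi j hj, mul_zero],
      mul_zero, neg_zero]
  rw [MAC.normV2_add_mul, horth]
  simp only [add_sub_cancel_left, mul_zero, add_zero]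
end

section
/- H¹-orthogonality of the discrete pressure projection: let ψ be a cell-centered grid function (with the discrete homogeneous Neumann ghost extension), let e be a MAC vector grid function satisfying the discrete no-penetration and free-slip conditions with (∇_h·e)_{i+1/2,j+1/2} = 0 at every cell, let c ∈ ℝ, and set ê := e + c ∇_h ψ. Then ‖∇_h ê‖₂² = ‖∇_h e‖₂² + ‖∇_h(ê − e)‖₂², where the ghost values entering ∇_h ê and ∇_h(ê − e) are those inherited from the Neumann extension of ψ and the free-slip extension of e. -/
namespace MAC

open Finset

/-- Summation by parts on `{0, …, N}` for a factor `u` vanishing at both ends. -/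
theorem sum_mul_backward_diff (N : ℕ) (u a : ℤ → ℝ) (h0 : u 0 = 0) (hN : u N = 0) :
    ∑ i ∈ range (N + 1), u i * (a i - a (i - 1))
      = -∑ i ∈ range N, (u (i + 1) - u i) * a i := by
  have key : ∀ n : ℕ, ∑ i ∈ range (n + 1), u i * (a i - a (i - 1))
      = u n * a n - ∑ i ∈ range n, (u (i + 1) - u i) * a i := by
    intro n
    induction n with
    | zero => simp [h0]
    | succ n ih =>
      rw [sum_range_succ, ih, sum_range_succ]
      push_cast
      rw [add_sub_cancel_right]
      ring
  rw [key, hN]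
  ring

theorem cl_of_mem {N : ℕ} {i : ℕ} (hi : i ∈ range N) : cl N i = i := by
  have := mem_range.1 hi
  unfold cl
  omega

theorem cl_cl {N : ℕ} (hN : 0 < N) (i : ℤ) : cl N (cl N i) = cl N i := by
  unfold cl
  omega

theorem cl_neg_one {N : ℕ} (hN : 0 < N) : cl N (0 - 1) = cl N 0 := by
  unfold cl
  omega

theorem cl_self (N : ℕ) : cl N N = cl N (N - 1) := by
  unfold cl
  omega

theorem cl_mem {N : ℕ} (hN : 0 < N) (i : ℤ) : 0 ≤ cl N i ∧ cl N i < N := by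
  unfold cl
  omega

/-- Pairing the tangential difference of `v` with the mixed difference of `ψ` over the nodes
equals pairing the normal difference of `v` with the tangential second difference of `ψ` over
the cells. -/
theorem sum_nodes_mul_mixed_diff {N : ℕ} (hN : 0 < N) (ψ v : ℤ → ℤ → ℝ)
    (hv : ∀ j : ℤ, 0 ≤ j → j < N → v 0 j = 0 ∧ v N j = 0) :
    ∑ i ∈ range (N + 1), ∑ j ∈ range (N + 1),
        (extX N v i j - extX N v i (j - 1)) *
          ((extC N ψ i j - extC N ψ i (j - 1))
            - (extC N ψ (i - 1) j - extC N ψ (i - 1) (j - 1)))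
      = ∑ i ∈ range N, ∑ j ∈ range N, (v (i + 1) j - v i j) *
          (extC N ψ i (j + 1) - 2 * extC N ψ i j + extC N ψ i (j - 1)) := by
  have hv0 : ∀ j, v 0 (cl N j) = 0 := fun j => (hv _ (cl_mem hN j).1 (cl_mem hN j).2).1
  have hvN : ∀ j, v N (cl N j) = 0 := fun j => (hv _ (cl_mem hN j).1 (cl_mem hN j).2).2
  rw [sum_comm]
  have hx : ∀ j : ℕ, _ := fun j => sum_mul_backward_diff N
    (fun i => extX N v i j - extX N v i (j - 1))
    (fun i => extC N ψ i j - extC N ψ i (j - 1))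
    (by simp [extX, hv0]) (by simp [extX, hvN])
  simp only [hx, sum_neg_distrib]
  rw [sum_comm, ← sum_neg_distrib]
  refine sum_congr rfl fun i _ => ?_
  have hy := sum_mul_backward_diff N
    (fun j => extC N ψ i j - extC N ψ i (j - 1))
    (fun j => extX N v (i + 1) j - extX N v i j)
    (by simp only [extC, cl_neg_one hN, sub_self])
    (by simp only [extC, cl_self, sub_self])
  rw [neg_eq_iff_eq_neg, ← sum_neg_distrib]
  rw [← sum_neg_distrib] at hy
  refine Eq.trans (sum_congr rfl fun j _ => by ring) (hy.trans (sum_congr rfl fun j hj => ?_))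
  simp only [extX, cl_of_mem hj, add_sub_cancel_right]
  ring

/-- Polarization of `gnormV2`. -/
theorem gnormV2_add (N : ℕ) (h : ℝ) (ux uy vx vy : ℤ → ℤ → ℝ) :
    gnormV2 N h (fun i j => ux i j + vx i j) (fun i j => uy i j + vy i j)
      = gnormV2 N h ux uy + gnormV2 N h vx vy
        + 2 * h ^ 2 * h⁻¹ ^ 2 *
          (∑ i ∈ range N, ∑ j ∈ range N,
              (ux (i + 1) j - ux i j) * (vx (i + 1) j - vx i j)
            + ∑ i ∈ range (N + 1), ∑ j ∈ range (N + 1),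
              (extX N ux i j - extX N ux i (j - 1)) * (extX N vx i j - extX N vx i (j - 1))
            + ∑ i ∈ range (N + 1), ∑ j ∈ range (N + 1),
              (extY N uy i j - extY N uy (i - 1) j) * (extY N vy i j - extY N vy (i - 1) j)
            + ∑ i ∈ range N, ∑ j ∈ range N,
              (uy i (j + 1) - uy i j) * (vy i (j + 1) - vy i j)) := by
  have sq : ∀ (m : ℕ) (a a' b b' : ℕ → ℕ → ℝ),
      ∑ i ∈ range m, ∑ j ∈ range m, ((a i j + b i j - (a' i j + b' i j)) / h) ^ 2
        = ∑ i ∈ range m, ∑ j ∈ range m, ((a i j - a' i j) / h) ^ 2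
          + ∑ i ∈ range m, ∑ j ∈ range m, ((b i j - b' i j) / h) ^ 2
          + 2 * h⁻¹ ^ 2 *
            ∑ i ∈ range m, ∑ j ∈ range m, (a i j - a' i j) * (b i j - b' i j) := by
    intro m a a' b b'
    simp only [mul_sum, ← sum_add_distrib]
    exact sum_congr rfl fun i _ => sum_congr rfl fun j _ => by ring
  simp only [gnormV2, extX, extY, sq]
  ring

end MAC

open Finset in
/-- **H¹-orthogonality of the discrete pressure projection**: if `e` is a
discretely divergence-free MAC vector with no-penetration and free-slip
boundary conditions, `ψ` is cell-centered (Neumann ghost extension), and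
`ê := e + c ∇_h ψ`, then `‖∇_h ê‖₂² = ‖∇_h e‖₂² + ‖∇_h(ê − e)‖₂²`. -/
theorem projection_H1_orthogonality (N : ℕ) (hN : 2 ≤ N) (h : ℝ)
    (hh : h = 1 / N) (ψ ex ey : ℤ → ℤ → ℝ) (c : ℝ)
    (hex hey : ℤ → ℤ → ℝ)
    (hbc : MAC.NoPen N ex ey)
    (hdiv : ∀ i ∈ range N, ∀ j ∈ range N, MAC.divV h ex ey i j = 0)
    (hhex : ∀ i j : ℤ, hex i j = ex i j + c * MAC.gradX N h ψ i j)
    (hhey : ∀ i j : ℤ, hey i j = ey i j + c * MAC.gradY N h ψ i j) :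
    MAC.gnormV2 N h hex hey
      = MAC.gnormV2 N h ex ey
        + MAC.gnormV2 N h (fun i j => hex i j - ex i j)
            (fun i j => hey i j - ey i j) := by
  have hN0 : 0 < N := by omega
  have hne : h ≠ 0 := by
    rw [hh]
    positivity
  obtain rfl : hex = fun i j => ex i j + c * MAC.gradX N h ψ i j := by
    funext i j
    exact hhex i j
  obtain rfl : hey = fun i j => ey i j + c * MAC.gradY N h ψ i j := by
    funext i j
    exact hhey i j
  simp only [add_sub_cancel_left]
  rw [MAC.gnormV2_add, add_eq_left]
  refine mul_eq_zero_of_right _ ?_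
  have hX := MAC.sum_nodes_mul_mixed_diff hN0 ψ ex hbc.1
  have hY := MAC.sum_nodes_mul_mixed_diff hN0 (fun i j => ψ j i) (fun i j => ey j i) hbc.2
  rw [sum_comm, sum_comm (s := range N)] at hY
  have eX : ∑ i ∈ range (N + 1), ∑ j ∈ range (N + 1),
      (MAC.extX N ex i j - MAC.extX N ex i (j - 1)) *
        (MAC.extX N (fun i j => c * MAC.gradX N h ψ i j) i j
          - MAC.extX N (fun i j => c * MAC.gradX N h ψ i j) i (j - 1))
      = c / h * ∑ i ∈ range N, ∑ j ∈ range N, (ex (i + 1) j - ex i j) *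
          (MAC.extC N ψ i (j + 1) - 2 * MAC.extC N ψ i j + MAC.extC N ψ i (j - 1)) := by
    rw [← hX]
    simp only [mul_sum]
    refine sum_congr rfl fun i _ => sum_congr rfl fun j _ => ?_
    simp only [MAC.extX, MAC.gradX, MAC.extC, MAC.cl_cl hN0]
    ring
  have eY : ∑ i ∈ range (N + 1), ∑ j ∈ range (N + 1),
      (MAC.extY N ey i j - MAC.extY N ey (i - 1) j) *
        (MAC.extY N (fun i j => c * MAC.gradY N h ψ i j) i j
          - MAC.extY N (fun i j => c * MAC.gradY N h ψ i j) (i - 1) j)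
      = c / h * ∑ i ∈ range N, ∑ j ∈ range N, (ey i (j + 1) - ey i j) *
          (MAC.extC N ψ (i + 1) j - 2 * MAC.extC N ψ i j + MAC.extC N ψ (i - 1) j) := by
    refine Eq.trans ?_ (congrArg (c / h * ·) hY)
    simp only [mul_sum]
    refine sum_congr rfl fun i _ => sum_congr rfl fun j _ => ?_
    simp only [MAC.extX, MAC.extY, MAC.gradY, MAC.extC, MAC.cl_cl hN0]
    ring
  rw [eX, eY]
  simp only [mul_sum, ← sum_add_distrib]
  refine sum_eq_zero fun i hi => sum_eq_zero fun j hj => ?_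
  have hd : ey i (j + 1) - ey i j = -(ex (i + 1) j - ex i j) := by
    have := hdiv i hi j hj
    rw [MAC.divV, ← add_div, div_eq_zero_iff, or_iff_left hne] at this
    linarith
  simp only [hd, MAC.gradX, MAC.gradY, add_sub_cancel_right]
  ring
end

section
/- Lipschitz estimates for the discrete SAV energy: let f and g be cell-centered grid functions with ‖f‖_∞ ≤ A and ‖g‖_∞ ≤ B for constants A, B ≥ 0. Then |E_{1,h}(f) − E_{1,h}(g)| ≤ (1/4)(A³ + B³ + (AB + 2)(A + B)) · ‖f − g‖₂, and consequently, since E_{1,h}(f) ≥ 1 and E_{1,h}(g) ≥ 1, also |√(E_{1,h}(f)) − √(E_{1,h}(g))| ≤ (1/8)(A³ + B³ + (AB + 2)(A + B)) · ‖f − g‖₂. -/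
/-- Pointwise Lipschitz bound for the density of the discrete SAV energy. -/
theorem abs_doubleWell_sub_le {a b A B : ℝ} (ha : |a| ≤ A) (hb : |b| ≤ B) :
    |((1 / 4) * a ^ 4 - (1 / 2) * a ^ 2 + 5 / 4) - ((1 / 4) * b ^ 4 - (1 / 2) * b ^ 2 + 5 / 4)|
      ≤ (1 / 4) * (A ^ 3 + B ^ 3 + (A * B + 2) * (A + B)) * |a - b| := by
  have hA : 0 ≤ A := (abs_nonneg a).trans ha
  have hB : 0 ≤ B := (abs_nonneg b).trans hb
  have hsum : |a + b| ≤ A + B := (abs_add_le a b).trans (add_le_add ha hb)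
  have ha2 : a ^ 2 ≤ A ^ 2 := sq_le_sq' (abs_le.mp ha).1 (abs_le.mp ha).2
  have hb2 : b ^ 2 ≤ B ^ 2 := sq_le_sq' (abs_le.mp hb).1 (abs_le.mp hb).2
  have hsq : |a ^ 2 + b ^ 2 - 2| ≤ A ^ 2 + B ^ 2 + 2 := by
    rw [abs_le]
    constructor <;> nlinarith [sq_nonneg a, sq_nonneg b]
  calc |((1 / 4) * a ^ 4 - (1 / 2) * a ^ 2 + 5 / 4)
          - ((1 / 4) * b ^ 4 - (1 / 2) * b ^ 2 + 5 / 4)|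
      = |(1 / 4) * ((a + b) * (a ^ 2 + b ^ 2 - 2)) * (a - b)| := by ring_nf
    _ = (1 / 4) * (|a + b| * |a ^ 2 + b ^ 2 - 2|) * |a - b| := by
        simp only [abs_mul]
        norm_num
    _ ≤ (1 / 4) * ((A + B) * (A ^ 2 + B ^ 2 + 2)) * |a - b| := by gcongr
    _ = (1 / 4) * (A ^ 3 + B ^ 3 + (A * B + 2) * (A + B)) * |a - b| := by ring

open Finset in
/-- The discrete `L¹` norm on the unit square is bounded by the discrete `L²` norm. -/
theorem sum_abs_le_sqrt_normC2 (N : ℕ) (d : ℤ → ℤ → ℝ) :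
    (1 / (N : ℝ)) ^ 2 * ∑ i ∈ range N, ∑ j ∈ range N, |d i j|
      ≤ Real.sqrt (MAC.normC2 N (1 / N) d) := by
  rcases Nat.eq_zero_or_pos N with rfl | hN
  · simp
  have hN' : (N : ℝ) ≠ 0 := by positivity
  apply Real.le_sqrt_of_sq_le
  have hcs := sq_sum_le_card_mul_sum_sq (s := range N ×ˢ range N)
    (f := fun p : ℕ × ℕ => |d p.1 p.2|)
  simp only [sum_product, card_product, card_range, sq_abs, Nat.cast_mul] at hcs
  simp only [MAC.normC2, MAC.ipC, ← sq]
  calc ((1 / (N : ℝ)) ^ 2 * ∑ i ∈ range N, ∑ j ∈ range N, |d i j|) ^ 2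
      = (1 / (N : ℝ)) ^ 4 * (∑ i ∈ range N, ∑ j ∈ range N, |d i j|) ^ 2 := by ring
    _ ≤ (1 / (N : ℝ)) ^ 4 * ((N : ℝ) * N * ∑ i ∈ range N, ∑ j ∈ range N, d i j ^ 2) := by
        gcongr
    _ = (1 / (N : ℝ)) ^ 2 * ∑ i ∈ range N, ∑ j ∈ range N, d i j ^ 2 := by
        field_simp

open Finset in
/-- The discrete SAV energy on the unit square is at least one. -/
theorem one_le_E1h {N : ℕ} (hN : N ≠ 0) (f : ℤ → ℤ → ℝ) : 1 ≤ MAC.E1h N (1 / N) f := by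
  have hN' : (N : ℝ) ≠ 0 := Nat.cast_ne_zero.mpr hN
  calc (1 : ℝ) = (1 / (N : ℝ)) ^ 2 * ∑ _i ∈ range N, ∑ _j ∈ range N, (1 : ℝ) := by
        simp only [sum_const, card_range, nsmul_eq_mul]
        field_simp
    _ ≤ MAC.E1h N (1 / N) f := by
        unfold MAC.E1h
        gcongr with i _ j _
        nlinarith [sq_nonneg (f i j ^ 2 - 1)]

/-- The square root is `1/2`-Lipschitz on `[1, ∞)`. -/
theorem abs_sqrt_sub_sqrt_le_half {x y : ℝ} (hx : 1 ≤ x) (hy : 1 ≤ y) :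
    |Real.sqrt x - Real.sqrt y| ≤ (1 / 2) * |x - y| := by
  have hsx : 1 ≤ Real.sqrt x := Real.one_le_sqrt.mpr hx
  have hsy : 1 ≤ Real.sqrt y := Real.one_le_sqrt.mpr hy
  have hfac : |x - y| = |Real.sqrt x - Real.sqrt y| * (Real.sqrt x + Real.sqrt y) := by
    rw [← abs_of_nonneg (show 0 ≤ Real.sqrt x + Real.sqrt y by linarith), ← abs_mul]
    congr 1
    nlinarith [Real.sq_sqrt (show 0 ≤ x by linarith), Real.sq_sqrt (show 0 ≤ y by linarith)]
  nlinarith [abs_nonneg (Real.sqrt x - Real.sqrt y)]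

open Finset in
/-- **Lipschitz estimates for the discrete SAV energy**: if `‖f‖_∞ ≤ A` and
`‖g‖_∞ ≤ B`, then
`|E_{1,h}(f) − E_{1,h}(g)| ≤ (1/4)(A³ + B³ + (AB + 2)(A + B)) ‖f − g‖₂`, and
(since `E_{1,h} ≥ 1`) also
`|√E_{1,h}(f) − √E_{1,h}(g)| ≤ (1/8)(A³ + B³ + (AB + 2)(A + B)) ‖f − g‖₂`. -/
theorem E1h_lipschitz (N : ℕ) (hN : 2 ≤ N) (h : ℝ) (hh : h = 1 / N)
    (f g : ℤ → ℤ → ℝ) (A B : ℝ) (hA : 0 ≤ A) (hB : 0 ≤ B)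
    (hf : ∀ i ∈ range N, ∀ j ∈ range N, |f i j| ≤ A)
    (hg : ∀ i ∈ range N, ∀ j ∈ range N, |g i j| ≤ B) :
    |MAC.E1h N h f - MAC.E1h N h g|
        ≤ (1 / 4) * (A ^ 3 + B ^ 3 + (A * B + 2) * (A + B))
            * Real.sqrt (MAC.normC2 N h (fun i j => f i j - g i j)) ∧
      |Real.sqrt (MAC.E1h N h f) - Real.sqrt (MAC.E1h N h g)|
        ≤ (1 / 8) * (A ^ 3 + B ^ 3 + (A * B + 2) * (A + B))
            * Real.sqrt (MAC.normC2 N h (fun i j => f i j - g i j)) := by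
  subst hh
  have hE : |MAC.E1h N (1 / N) f - MAC.E1h N (1 / N) g|
      ≤ (1 / 4) * (A ^ 3 + B ^ 3 + (A * B + 2) * (A + B))
          * Real.sqrt (MAC.normC2 N (1 / N) (fun i j => f i j - g i j)) := by
    refine le_trans ?_ (mul_le_mul_of_nonneg_left
      (sum_abs_le_sqrt_normC2 N fun i j => f i j - g i j) (by positivity))
    unfold MAC.E1h
    rw [← mul_sub, abs_mul, abs_of_nonneg (by positivity : (0 : ℝ) ≤ (1 / (N : ℝ)) ^ 2),
      mul_left_comm]
    gcongr
    simp only [← sum_sub_distrib, mul_sum]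
    refine (abs_sum_le_sum_abs _ _).trans (sum_le_sum fun i hi => ?_)
    exact (abs_sum_le_sum_abs _ _).trans
      (sum_le_sum fun j hj => abs_doubleWell_sub_le (hf i hi j hj) (hg i hi j hj))
  have hN0 : N ≠ 0 := by omega
  refine ⟨hE, (abs_sqrt_sub_sqrt_le_half (one_le_E1h hN0 f) (one_le_E1h hN0 g)).trans ?_⟩
  linarith
end
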